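/- arXiv:1307.5037 — 2 statements merged into one kernel-verified Lean document; each statement's English description precedes it below -/
import Mathlib

section
/- The intersection Bad(1/3, 2/3) ∩ Bad(2/3, 1/3) is nonempty (Schmidt's conjecture). -/
open Metric Filter

/-- Distance from a real number to the nearest integer. -/
noncomputable def distNearestInt (x : ℝ) : ℝ := |x - ((round x : ℤ) : ℝ)|

/-- The set `Bad(s,t) ⊆ ℝ²` of pairs `(x,y)` such that
`inf_{q ∈ ℕ⁺} max (q^s ‖qx‖) (q^t ‖qy‖) > 0`. -/
noncomputable def badPair (s t : ℝ) : Set (ℝ × ℝ) :=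
  {p | 0 < ⨅ q : ℕ+, max (((q : ℕ) : ℝ) ^ s * distNearestInt (((q : ℕ) : ℝ) * p.1))
      (((q : ℕ) : ℝ) ^ t * distNearestInt (((q : ℕ) : ℝ) * p.2))}

/-- A rational point `(p/q, r/q)` together with a rational line `a x + b y + e = 0`. -/
structure FlaggedPoint where
  q : ℤ
  p : ℤ
  r : ℤ
  a : ℤ
  b : ℤ
  e : ℤ

namespace FlaggedPoint

/-- The height of a flagged point, the product of the denominator and the slope denominator. -/
noncomputable def height (v : FlaggedPoint) : ℝ := v.q * |(v.b : ℝ)|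

/-- The point of `v` violates the `(i, j)`-approximation bound at `(x, y)` with constant `c`,
and the line of `v` is a non-vertical line through this point with small coefficients. -/
structure Hits (c i j x : ℝ) (v : FlaggedPoint) (y : ℝ) : Prop where
  q_pos : 0 < v.q
  x_near : |v.q * x - v.p| < c * (v.q : ℝ) ^ (-i)
  y_near : |v.q * y - v.r| < c * (v.q : ℝ) ^ (-j)
  incident : v.a * v.p + v.b * v.r + v.e * v.q = 0
  a_le : |(v.a : ℝ)| ≤ (v.q : ℝ) ^ i
  b_le : |(v.b : ℝ)| ≤ (v.q : ℝ) ^ j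
  b_ne : v.b ≠ 0

namespace Hits

variable {c i j x y : ℝ} {v : FlaggedPoint}

lemma one_le_q (h : v.Hits c i j x y) : (1 : ℝ) ≤ v.q := by exact_mod_cast h.q_pos

lemma one_le_b (h : v.Hits c i j x y) : (1 : ℝ) ≤ |(v.b : ℝ)| := by
  exact_mod_cast Int.one_le_abs h.b_ne

lemma incident_real (h : v.Hits c i j x y) :
    (v.a : ℝ) * v.p + v.b * v.r + v.e * v.q = 0 := by exact_mod_cast h.incident

lemma q_le_height (h : v.Hits c i j x y) : (v.q : ℝ) ≤ v.height :=
  le_mul_of_one_le_right (by linarith [h.one_le_q]) h.one_le_b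

lemma height_le (h : v.Hits c i j x y) : v.height ≤ (v.q : ℝ) ^ (1 + j) := by
  have hq : (0 : ℝ) < v.q := by linarith [h.one_le_q]
  rw [Real.rpow_add hq, Real.rpow_one]
  exact mul_le_mul_of_nonneg_left h.b_le hq.le

/-- The line of a hitting flagged point passes close to every `(x, z)` with `z` close to `y`. -/
lemma abs_line_le (h : v.Hits c i j x y) {z d : ℝ} (hz : |z - y| ≤ d) :
    v.q * |v.a * x + v.b * z + v.e| ≤ 2 * c + v.height * d := by
  have hq : (0 : ℝ) < v.q := by linarith [h.one_le_q]
  have e1 : (v.q : ℝ) * (v.a * x + v.b * z + v.e)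
      = v.a * (v.q * x - v.p) + v.b * (v.q * y - v.r) + v.q * v.b * (z - y) := by
    linear_combination h.incident_real
  have b1 : |(v.a : ℝ) * (v.q * x - v.p)| ≤ c := by
    rw [abs_mul]
    calc _ ≤ (v.q : ℝ) ^ i * (c * (v.q : ℝ) ^ (-i)) :=
          mul_le_mul h.a_le h.x_near.le (abs_nonneg _) (by positivity)
      _ = c * ((v.q : ℝ) ^ i * (v.q : ℝ) ^ (-i)) := by ring
      _ = c := by rw [← Real.rpow_add hq]; simp
  have b2 : |(v.b : ℝ) * (v.q * y - v.r)| ≤ c := by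
    rw [abs_mul]
    calc _ ≤ (v.q : ℝ) ^ j * (c * (v.q : ℝ) ^ (-j)) :=
          mul_le_mul h.b_le h.y_near.le (abs_nonneg _) (by positivity)
      _ = c * ((v.q : ℝ) ^ j * (v.q : ℝ) ^ (-j)) := by ring
      _ = c := by rw [← Real.rpow_add hq]; simp
  have b3 : |(v.q : ℝ) * v.b * (z - y)| ≤ v.height * d := by
    rw [abs_mul, abs_mul, abs_of_pos hq]
    exact mul_le_mul_of_nonneg_left hz (by positivity)
  rw [← abs_of_pos hq, ← abs_mul, e1]
  refine (abs_add_three _ _ _).trans ?_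
  linarith

end Hits

end FlaggedPoint

lemma abs_mul_sqrt_two_sub_ge (a m : ℤ) (ha : a ≠ 0) :
    1 / (4 * |(a : ℝ)|) ≤ |a * √2 - m| := by
  have h1 : (1 : ℝ) ≤ |(a : ℝ)| := by exact_mod_cast Int.one_le_abs ha
  have hs : √2 * √2 = 2 := Real.mul_self_sqrt (by norm_num)
  have hs0 : 0 ≤ √2 := Real.sqrt_nonneg 2
  have hs1 : √2 ≤ 3 / 2 := by nlinarith
  by_contra! hlt
  have h2 : |a * √2 - m| < 1 := hlt.trans_le (by rw [div_le_one (by positivity)]; linarith)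
  have hne : 2 * a ^ 2 - m ^ 2 ≠ 0 := by
    intro h
    have h' : (2 : ℝ) * a ^ 2 = m ^ 2 := by exact_mod_cast sub_eq_zero.mp h
    have ha' : (a : ℝ) ≠ 0 := by exact_mod_cast ha
    apply irrational_sqrt_two
    refine ⟨|(m : ℚ) / a|, ?_⟩
    have : ((m : ℝ) / a) ^ 2 = 2 := by rw [div_pow, ← h']; field_simp
    rw [← this, Real.sqrt_sq_eq_abs]
    push_cast
    rfl
  have h3 : (1 : ℝ) ≤ |2 * (a : ℝ) ^ 2 - m ^ 2| := by exact_mod_cast Int.one_le_abs hne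
  have h4 : 2 * (a : ℝ) ^ 2 - m ^ 2 = (a * √2 - m) * (a * √2 + m) := by
    linear_combination (-(a : ℝ) ^ 2) * hs
  have h5 : |a * √2 + m| ≤ 4 * |(a : ℝ)| := by
    have : a * √2 + m = 2 * (a * √2) - (a * √2 - m) := by ring
    rw [this]
    refine (abs_sub _ _).trans ?_
    rw [abs_mul, abs_mul, abs_of_nonneg hs0, abs_two]
    nlinarith
  rw [h4, abs_mul] at h3
  have h6 : |a * √2 - m| * |a * √2 + m| ≤ |a * √2 - m| * (4 * |(a : ℝ)|) :=
    mul_le_mul_of_nonneg_left h5 (abs_nonneg _)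
  rw [lt_div_iff₀ (by positivity)] at hlt
  linarith

lemma exists_small_line {q : ℤ} (p r : ℤ) {X Y : ℝ} (hX : 0 ≤ X) (hY : 0 ≤ Y) (hq : 0 < q)
    (hXY : (q : ℝ) ≤ X * Y) :
    ∃ a b e : ℤ, a * p + b * r + e * q = 0 ∧ |(a : ℝ)| ≤ X ∧ |(b : ℝ)| ≤ Y ∧
      (a ≠ 0 ∨ b ≠ 0) := by
  have hcard : (Finset.Ico (0 : ℤ) q).card
      < (Finset.Icc (0 : ℤ) ⌊X⌋ ×ˢ Finset.Icc (0 : ℤ) ⌊Y⌋).card := by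
    have hX' := Int.floor_nonneg.mpr hX
    have hY' := Int.floor_nonneg.mpr hY
    rw [Finset.card_product, Int.card_Ico, Int.card_Icc, Int.card_Icc]
    zify
    rw [Int.toNat_of_nonneg (by omega), Int.toNat_of_nonneg (by omega),
      Int.toNat_of_nonneg (by omega)]
    have h1 := Int.lt_floor_add_one X
    have h2 := Int.lt_floor_add_one Y
    have : (q : ℝ) < (⌊X⌋ + 1) * (⌊Y⌋ + 1) :=
      hXY.trans_lt (mul_lt_mul'' h1 h2 hX hY)
    have : q < (⌊X⌋ + 1) * (⌊Y⌋ + 1) := by exact_mod_cast this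
    simpa using this
  obtain ⟨⟨a, b⟩, hab, ⟨a', b'⟩, hab', hne, heq⟩ :=
    Finset.exists_ne_map_eq_of_card_lt_of_maps_to (f := fun z : ℤ × ℤ => (z.1 * p + z.2 * r) % q)
      hcard (fun z _ => by
        simpa using ⟨Int.emod_nonneg _ hq.ne', Int.emod_lt_of_pos _ hq⟩)
  simp only [Finset.mem_product, Finset.mem_Icc, Int.le_floor] at hab hab'
  obtain ⟨⟨ha0, ha⟩, hb0, hb⟩ := hab
  obtain ⟨⟨ha0', ha'⟩, hb0', hb'⟩ := hab'
  obtain ⟨e, he⟩ := Int.ModEq.dvd heq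
  refine ⟨a' - a, b' - b, -e, by linear_combination he, ?_, ?_, ?_⟩
  · have : (0 : ℝ) ≤ a := by exact_mod_cast ha0
    have : (0 : ℝ) ≤ a' := by exact_mod_cast ha0'
    push_cast
    rw [abs_le]; constructor <;> linarith
  · have : (0 : ℝ) ≤ b := by exact_mod_cast hb0
    have : (0 : ℝ) ≤ b' := by exact_mod_cast hb0'
    push_cast
    rw [abs_le]; constructor <;> linarith
  · by_contra! h
    exact hne (Prod.ext (by simpa using (sub_eq_zero.mp h.1).symm)
      (by simpa using (sub_eq_zero.mp h.2).symm))

/-- Every rational point violating the approximation bound at `(√2, y)` carries a suitable line. -/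
lemma exists_hits {c i j y : ℝ} (hc : c ≤ 1 / 4) (hi1 : i ≤ 1) (hij : i + j = 1)
    {q p r : ℤ} (hq : 0 < q) (hx : |q * √2 - p| < c * (q : ℝ) ^ (-i))
    (hy : |q * y - r| < c * (q : ℝ) ^ (-j)) :
    ∃ v : FlaggedPoint, v.q = q ∧ v.Hits c i j √2 y := by
  have hq1 : (1 : ℝ) ≤ q := by exact_mod_cast hq
  have hq0 : (0 : ℝ) < q := by linarith
  obtain ⟨a, b, e, hline, ha, hb, hab⟩ :=
    exists_small_line p r (X := (q : ℝ) ^ i) (Y := (q : ℝ) ^ j) (by positivity) (by positivity) hq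
      (by rw [← Real.rpow_add hq0, hij, Real.rpow_one])
  refine ⟨⟨q, p, r, a, b, e⟩, rfl, hq, hx, hy, hline, ha, hb, ?_⟩
  rintro rfl
  have ha0 : a ≠ 0 := by tauto
  have ha1 : (1 : ℝ) ≤ |(a : ℝ)| := by exact_mod_cast Int.one_le_abs ha0
  have hlow := abs_mul_sqrt_two_sub_ge a (-e) ha0
  have hline' : (a : ℝ) * p + e * q = 0 := by
    have : a * p + e * q = 0 := by linarith
    exact_mod_cast this
  have e1 : q * |a * √2 - ((-e : ℤ) : ℝ)| = |(a : ℝ)| * |q * √2 - p| := by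
    rw [← abs_of_pos hq0, ← abs_mul, abs_of_pos hq0, ← abs_mul]
    congr 1
    push_cast
    linear_combination hline'
  have h2 : |(a : ℝ)| * |q * √2 - p| < c := by
    calc |(a : ℝ)| * |q * √2 - p| < |(a : ℝ)| * (c * (q : ℝ) ^ (-i)) := by gcongr
      _ ≤ (q : ℝ) ^ i * (c * (q : ℝ) ^ (-i)) := by
        have : 0 < c * (q : ℝ) ^ (-i) := (abs_nonneg _).trans_lt hx
        gcongr
      _ = c * ((q : ℝ) ^ i * (q : ℝ) ^ (-i)) := by ring
      _ = c := by rw [← Real.rpow_add hq0]; simp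
  have h3 : |(a : ℝ)| ≤ q := ha.trans (by
    simpa using Real.rpow_le_rpow_of_exponent_le hq1 hi1)
  have h4 : 1 / 4 ≤ q * (1 / (4 * |(a : ℝ)|)) := by
    rw [mul_one_div, div_le_div_iff₀ (by norm_num) (by positivity)]
    linarith
  have h5 : q * (1 / (4 * |(a : ℝ)|)) ≤ q * |a * √2 - ((-e : ℤ) : ℝ)| := by gcongr
  linarith

lemma mul_le_rpow_add {ρ X Y s t : ℝ} (hρ : 0 < ρ) (hY0 : 0 ≤ Y) (hX : X ≤ ρ ^ s)
    (hY : Y ≤ ρ ^ t) : X * Y ≤ ρ ^ (s + t) := by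
  rw [Real.rpow_add hρ]
  exact mul_le_mul hX hY hY0 (by positivity)

lemma rpow_le_rpow_mul {ρ X s t : ℝ} (hρ : 0 < ρ) (hX0 : 0 ≤ X) (hX : X ≤ ρ ^ s)
    (ht : 0 ≤ t) : X ^ t ≤ ρ ^ (s * t) := by
  rw [Real.rpow_mul hρ.le]
  exact Real.rpow_le_rpow hX0 hX ht

lemma two_le_rpow {ρ : ℝ} (hρ : 2 ^ 250 ≤ ρ) : 2 ≤ ρ ^ (1 / 100 : ℝ) := by
  calc (2 : ℝ) ≤ ((2 : ℝ) ^ (250 : ℝ)) ^ (1 / 100 : ℝ) := by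
        rw [← Real.rpow_mul (by norm_num)]
        simpa using Real.rpow_le_rpow_of_exponent_le (one_le_two (α := ℝ))
          (show (1 : ℝ) ≤ 250 * (1 / 100) by norm_num)
    _ ≤ ρ ^ (1 / 100 : ℝ) := by
        apply Real.rpow_le_rpow (by positivity) _ (by norm_num)
        exact_mod_cast hρ

lemma rpow_neg_seven_le {ρ : ℝ} (hρ : 2 ^ 250 ≤ ρ) : ρ ^ (-7 : ℝ) ≤ 1 / 4 := by
  have hρ4 : 4 ≤ ρ := le_trans (by norm_num) hρ
  calc ρ ^ (-7 : ℝ) ≤ ρ ^ (-1 : ℝ) :=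
        Real.rpow_le_rpow_of_exponent_le (by linarith) (by norm_num)
    _ = 1 / ρ := by rw [Real.rpow_neg_one, one_div]
    _ ≤ 1 / 4 := one_div_le_one_div_of_le (by norm_num) hρ4

lemma add_le_rpow {ρ X Y s : ℝ} (hρ : 2 ^ 250 ≤ ρ) (hX : X ≤ ρ ^ s) (hY : Y ≤ ρ ^ s) :
    X + Y ≤ ρ ^ (s + 1 / 100) := by
  have hρ0 : 0 < ρ := lt_of_lt_of_le (by positivity) hρ
  rw [Real.rpow_add hρ0]
  nlinarith [two_le_rpow hρ, Real.rpow_pos_of_pos hρ0 s]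

lemma abs_sub_mul_le_rpow {ρ X Y Z W s t : ℝ} (hρ : 2 ^ 250 ≤ ρ) (hX : |X| ≤ ρ ^ s)
    (hY : |Y| ≤ ρ ^ t) (hZ : |Z| ≤ ρ ^ s) (hW : |W| ≤ ρ ^ t) :
    |X * Y - Z * W| ≤ ρ ^ (s + t + 1 / 100) := by
  have hρ0 : 0 < ρ := lt_of_lt_of_le (by positivity) hρ
  refine (abs_sub _ _).trans (add_le_rpow hρ ?_ ?_)
  · rw [abs_mul]; exact mul_le_rpow_add hρ0 (abs_nonneg _) hX hY
  · rw [abs_mul]; exact mul_le_rpow_add hρ0 (abs_nonneg _) hZ hW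

/-- The two pairs of exponents under consideration. -/
def IsWeight (i j : ℝ) : Prop := (i = 1 / 3 ∧ j = 2 / 3) ∨ (i = 2 / 3 ∧ j = 1 / 3)

namespace FlaggedPoint

/-- Membership of a flagged point in the class of level `n` and index `t`. -/
structure InClass (ρ j : ℝ) (n t : ℕ) (v : FlaggedPoint) : Prop where
  le_height : ρ ^ n ≤ v.height
  height_lt : v.height < ρ ^ (n + 1)
  le_q : ρ ^ (n + t) ≤ (v.q : ℝ) ^ (1 + j)
  q_lt : (v.q : ℝ) ^ (1 + j) < ρ ^ (n + t + 1)

section Class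

variable {ρ i j y z : ℝ} {n t k : ℕ} {v v₁ v₂ : FlaggedPoint}

lemma InClass.rpow_le_q (hρ : 2 ^ 250 ≤ ρ) (hw : IsWeight i j) {c x : ℝ}
    (hv : v.Hits c i j x y) (hc : v.InClass ρ j n t) : ρ ^ ((n + t) / (1 + j)) ≤ v.q := by
  have hρ0 : 0 < ρ := lt_of_lt_of_le (by positivity) hρ
  have hj : 0 < 1 + j := by rcases hw with ⟨_, rfl⟩ | ⟨_, rfl⟩ <;> norm_num
  have hq := hv.one_le_q
  rw [← Real.rpow_le_rpow_iff (z := 1 + j) (by positivity) (by linarith) hj,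
    ← Real.rpow_mul hρ0.le, div_mul_cancel₀ _ hj.ne']
  exact_mod_cast hc.le_q

lemma InClass.q_le_rpow (hρ : 2 ^ 250 ≤ ρ) (hw : IsWeight i j) {c x : ℝ}
    (hv : v.Hits c i j x y) (hc : v.InClass ρ j n t) :
    v.q ≤ ρ ^ ((n + t) / (1 + j) + 1) := by
  have hρ0 : 0 < ρ := lt_of_lt_of_le (by positivity) hρ
  have hj0 : 0 ≤ j := by rcases hw with ⟨_, rfl⟩ | ⟨_, rfl⟩ <;> norm_num
  have hj : 0 < 1 + j := by linarith
  have hq := hv.one_le_q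
  have hρ1 : 1 ≤ ρ := le_trans (by norm_num) hρ
  rw [← Real.rpow_le_rpow_iff (z := 1 + j) (by linarith) (by positivity) hj,
    ← Real.rpow_mul hρ0.le, add_mul, div_mul_cancel₀ _ hj.ne']
  refine hc.q_lt.le.trans ?_
  rw [← Real.rpow_natCast]
  apply Real.rpow_le_rpow_of_exponent_le hρ1
  push_cast
  linarith

lemma InClass.a_le_rpow (hρ : 2 ^ 250 ≤ ρ) (hw : IsWeight i j) {c x : ℝ}
    (hv : v.Hits c i j x y) (hc : v.InClass ρ j n t) :
    |(v.a : ℝ)| ≤ ρ ^ (((n + t) / (1 + j) + 1) * i) := by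
  have hi : 0 ≤ i := by rcases hw with ⟨rfl, _⟩ | ⟨rfl, _⟩ <;> norm_num
  exact hv.a_le.trans (rpow_le_rpow_mul (lt_of_lt_of_le (by positivity) hρ)
    (by linarith [hv.one_le_q]) (hc.q_le_rpow hρ hw hv) hi)

lemma InClass.le_rpow_sub (hρ : 2 ^ 250 ≤ ρ) (hw : IsWeight i j) {c x : ℝ}
    (hv : v.Hits c i j x y) (hc : v.InClass ρ j n t) {X s : ℝ} (hX0 : 0 ≤ X)
    (hX : v.q * X ≤ ρ ^ s) : X ≤ ρ ^ (s - (n + t) / (1 + j)) := by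
  have hρ0 : 0 < ρ := lt_of_lt_of_le (by positivity) hρ
  rw [Real.rpow_sub hρ0, le_div_iff₀ (by positivity), mul_comm]
  exact (mul_le_mul_of_nonneg_right (hc.rpow_le_q hρ hw hv) hX0).trans hX

lemma InClass.b_le_rpow (hρ : 2 ^ 250 ≤ ρ) (hw : IsWeight i j) {c x : ℝ}
    (hv : v.Hits c i j x y) (hc : v.InClass ρ j n t) :
    |(v.b : ℝ)| ≤ ρ ^ ((n + 1 : ℝ) - (n + t) / (1 + j)) := by
  refine hc.le_rpow_sub hρ hw hv (abs_nonneg _) (hc.height_lt.le.trans_eq ?_)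
  exact_mod_cast (Real.rpow_natCast ρ (n + 1)).symm

lemma abs_line_le_rpow (hρ : 2 ^ 250 ≤ ρ) (hv : v.Hits (ρ ^ (-7 : ℝ)) i j √2 y)
    (hc : v.InClass ρ j n t) (hz : |z - y| ≤ ρ ^ (k - n - 4 : ℝ)) :
    v.q * |v.a * √2 + v.b * z + v.e| ≤ ρ ^ (k - 5 / 2 : ℝ) := by
  have hρ0 : 0 < ρ := lt_of_lt_of_le (by positivity) hρ
  have hρ1 : 1 ≤ ρ := le_trans (by norm_num) hρ
  refine (hv.abs_line_le hz).trans ?_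
  have h1 : v.height ≤ ρ ^ (n + 1 : ℝ) := by exact_mod_cast hc.height_lt.le
  have h2 : v.height * ρ ^ (k - n - 4 : ℝ) ≤ ρ ^ (k - 3 : ℝ) := by
    convert mul_le_rpow_add hρ0 (by positivity) h1 le_rfl using 2
    ring
  have h3 : 2 * ρ ^ (-7 : ℝ) ≤ ρ ^ (k - 3 : ℝ) := by
    have := add_le_rpow hρ (le_refl (ρ ^ (-7 : ℝ))) (le_refl (ρ ^ (-7 : ℝ)))
    rw [two_mul]
    refine this.trans (Real.rpow_le_rpow_of_exponent_le hρ1 ?_)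
    have : (0 : ℝ) ≤ k := by positivity
    linarith
  refine (add_le_rpow hρ h3 h2).trans (Real.rpow_le_rpow_of_exponent_le hρ1 (by linarith))

/-- A rational point that is very close to `(√2, y)` has large height. -/
lemma not_close_of_forall_height_ge (hρ : 2 ^ 250 ≤ ρ) (hw : IsWeight i j)
    (hk : 100 * k ≤ t) (hk1 : 1 ≤ k)
    (hgood : ∀ v : FlaggedPoint, v.Hits (ρ ^ (-7 : ℝ)) i j √2 y →
      ρ ^ (n + 1 - k : ℝ) ≤ v.height)
    {q p r : ℤ} (hq : 0 < q) (hqle : (q : ℝ) ≤ ρ ^ (n + 2 - j * ((n + t) / (1 + j)) : ℝ))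
    (hx : |q * √2 - p| ≤ ρ ^ (n + k - 2 * ((n + t) / (1 + j)) : ℝ))
    (hy : |q * y - r| ≤ ρ ^ (k - 1 - j * ((n + t) / (1 + j)) : ℝ)) : False := by
  have hρ0 : 0 < ρ := lt_of_lt_of_le (by positivity) hρ
  have hρ1 : 1 < ρ := lt_of_lt_of_le (by norm_num) hρ
  have hq0 : (0 : ℝ) < q := by exact_mod_cast hq
  have hk' : (100 : ℝ) * k ≤ t := by exact_mod_cast hk
  have hk1' : (1 : ℝ) ≤ k := by exact_mod_cast hk1
  have hi : 0 ≤ i ∧ i ≤ 1 ∧ i + j = 1 ∧ 0 ≤ j := by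
    rcases hw with ⟨rfl, rfl⟩ | ⟨rfl, rfl⟩ <;> norm_num
  obtain ⟨hi0, hi1, hij, hj0⟩ := hi
  have hτ : (n + t) / (1 + j) * (1 + j) = n + t :=
    div_mul_cancel₀ _ (by rcases hw with ⟨_, rfl⟩ | ⟨_, rfl⟩ <;> norm_num)
  generalize (n + t) / (1 + j) = τ at *
  have hc := rpow_neg_seven_le hρ
  have low : ∀ s : ℝ, 0 ≤ s →
      ρ ^ (-7 - (n + 2 - j * τ) * s) ≤ ρ ^ (-7 : ℝ) * (q : ℝ) ^ (-s) := by
    intro s hs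
    rw [sub_eq_add_neg, Real.rpow_add hρ0, Real.rpow_neg hρ0.le (_ * s), Real.rpow_neg hq0.le]
    have := rpow_le_rpow_mul hρ0 hq0.le hqle hs
    gcongr
  obtain ⟨v, rfl, hv⟩ := exists_hits (y := y) (p := p) (r := r) hc hi1 hij hq
    (hx.trans_lt ((Real.rpow_lt_rpow_of_exponent_lt hρ1 (by
      rcases hw with ⟨rfl, rfl⟩ | ⟨rfl, rfl⟩ <;> linarith)).trans_le (low i hi0)))
    (hy.trans_lt ((Real.rpow_lt_rpow_of_exponent_lt hρ1 (by
      rcases hw with ⟨rfl, rfl⟩ | ⟨rfl, rfl⟩ <;> linarith)).trans_le (low j hj0)))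
  have h1 := hv.height_le.trans (rpow_le_rpow_mul hρ0 hq0.le hqle (by linarith : 0 ≤ 1 + j))
  refine absurd (h1.trans_lt (Real.rpow_lt_rpow_of_exponent_lt hρ1 ?_)) (hgood v hv).not_gt
  rcases hw with ⟨rfl, rfl⟩ | ⟨rfl, rfl⟩ <;> linarith

/-- Two flagged points of the same class of large index near a good `y` have the same line. -/
lemma line_incident_of_large_index (hρ : 2 ^ 250 ≤ ρ) (hw : IsWeight i j)
    (hk : 100 * k ≤ t) (hk1 : 1 ≤ k)
    (hgood : ∀ v : FlaggedPoint, v.Hits (ρ ^ (-7 : ℝ)) i j √2 z →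
      ρ ^ (n + 1 - k : ℝ) ≤ v.height) {y₁ y₂ : ℝ}
    (h₁ : v₁.Hits (ρ ^ (-7 : ℝ)) i j √2 y₁) (c₁ : v₁.InClass ρ j n t)
    (h₂ : v₂.Hits (ρ ^ (-7 : ℝ)) i j √2 y₂) (c₂ : v₂.InClass ρ j n t)
    (hz₁ : |z - y₁| ≤ ρ ^ (k - n - 4 : ℝ)) (hz₂ : |z - y₂| ≤ ρ ^ (k - n - 4 : ℝ)) :
    v₁.a * v₂.p + v₁.b * v₂.r + v₁.e * v₂.q = 0 := by
  have hρ0 : 0 < ρ := lt_of_lt_of_le (by positivity) hρ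
  have hρ1 : 1 < ρ := lt_of_lt_of_le (by norm_num) hρ
  have hk' : (100 : ℝ) * k ≤ t := by exact_mod_cast hk
  have hk1' : (1 : ℝ) ≤ k := by exact_mod_cast hk1
  have hn0 : (0 : ℝ) ≤ n := by positivity
  have F₁ := c₁.le_rpow_sub hρ hw h₁ (abs_nonneg _) (abs_line_le_rpow hρ h₁ c₁ hz₁)
  have F₂ := c₂.le_rpow_sub hρ hw h₂ (abs_nonneg _) (abs_line_le_rpow hρ h₂ c₂ hz₂)
  have A₁ := c₁.a_le_rpow hρ hw h₁
  have A₂ := c₂.a_le_rpow hρ hw h₂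
  have B₁ := c₁.b_le_rpow hρ hw h₁
  have B₂ := c₂.b_le_rpow hρ hw h₂
  have hτ : (n + t) / (1 + j) * (1 + j) = n + t :=
    div_mul_cancel₀ _ (by rcases hw with ⟨_, rfl⟩ | ⟨_, rfl⟩ <;> norm_num)
  have hclose := @not_close_of_forall_height_ge ρ i j z n t k hρ hw hk hk1 hgood
  generalize (n + t) / (1 + j) = τ at *
  set F1 := v₁.a * √2 + v₁.b * z + v₁.e with hF1
  set F2 := v₂.a * √2 + v₂.b * z + v₂.e with hF2
  set q := v₁.a * v₂.b - v₂.a * v₁.b with hq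
  set p := v₁.b * v₂.e - v₂.b * v₁.e with hp
  set r := v₂.a * v₁.e - v₁.a * v₂.e with hr
  have hqb : |(q : ℝ)| ≤ ρ ^ (n + 2 - j * τ : ℝ) := by
    rw [hq]
    push_cast
    refine (abs_sub_mul_le_rpow hρ A₁ B₂ A₂ B₁).trans
      (Real.rpow_le_rpow_of_exponent_le hρ1.le ?_)
    rcases hw with ⟨rfl, rfl⟩ | ⟨rfl, rfl⟩ <;> linarith
  have hxb : |q * √2 - p| ≤ ρ ^ (n + k - 2 * τ : ℝ) := by
    have e1 : q * √2 - p = v₂.b * F1 - v₁.b * F2 := by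
      rw [hq, hp, hF1, hF2]; push_cast; ring
    rw [e1]
    refine (abs_sub_mul_le_rpow hρ B₂ F₁ B₁ F₂).trans
      (Real.rpow_le_rpow_of_exponent_le hρ1.le ?_)
    linarith
  have hyb : |q * z - r| ≤ ρ ^ (k - 1 - j * τ : ℝ) := by
    have e1 : q * z - r = v₁.a * F2 - v₂.a * F1 := by
      rw [hq, hr, hF1, hF2]; push_cast; ring
    rw [e1]
    refine (abs_sub_mul_le_rpow hρ A₁ F₂ A₂ F₁).trans
      (Real.rpow_le_rpow_of_exponent_le hρ1.le ?_)
    rcases hw with ⟨rfl, rfl⟩ | ⟨rfl, rfl⟩ <;> linarith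
  have hq0 : q = 0 := by
    rcases lt_trichotomy q 0 with h | h | h
    · refine (@hclose (-q) (-p) (-r) (by omega) ?_ ?_ ?_).elim
      · push_cast; exact (neg_le_abs _).trans hqb
      · rw [← abs_neg]; push_cast; convert hxb using 2; ring
      · rw [← abs_neg]; push_cast; convert hyb using 2; ring
    · exact h
    · exact (hclose h ((le_abs_self _).trans hqb) hxb hyb).elim
  have hp0 : p = 0 := by
    rw [hq0] at hxb
    have : |(p : ℝ)| < 1 := by
      have h1 : |(p : ℝ)| ≤ ρ ^ (n + k - 2 * τ : ℝ) := by simpa using hxb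
      refine h1.trans_lt (Real.rpow_lt_one_of_one_lt_of_neg hρ1 ?_)
      rcases hw with ⟨rfl, rfl⟩ | ⟨rfl, rfl⟩ <;> linarith
    exact Int.abs_lt_one_iff.mp (by exact_mod_cast this)
  have hmul : v₂.b * (v₁.a * v₂.p + v₁.b * v₂.r + v₁.e * v₂.q) = 0 := by
    linear_combination v₂.p * (hq.symm.trans hq0) + v₁.b * h₂.incident
      - v₂.q * (hp.symm.trans hp0)
  exact (mul_eq_zero.mp hmul).resolve_left h₂.b_ne

lemma abs_mul_error_le (hρ : 2 ^ 250 ≤ ρ) (hw : IsWeight i j) {c x y₁ y₂ : ℝ}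
    (h₁ : v₁.Hits c i j x y₁) (c₁ : v₁.InClass ρ j n t)
    (h₂ : v₂.Hits c i j x y₂) (c₂ : v₂.InClass ρ j n t) {X Y s : ℝ} (hs : 0 ≤ s) (hs1 : s ≤ 1)
    (hX : |X| ≤ (v₁.q : ℝ) ^ s) (hY : |Y| < ρ ^ (-7 : ℝ) * (v₂.q : ℝ) ^ (-s)) :
    |X * Y| ≤ ρ ^ (-6 : ℝ) := by
  have hρ0 : 0 < ρ := lt_of_lt_of_le (by positivity) hρ
  have hρ1 : 1 ≤ ρ := le_trans (by norm_num) hρ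
  have hq₁ := h₁.one_le_q
  have hq₂ := h₂.one_le_q
  have r₂ := c₂.rpow_le_q hρ hw h₂
  have s₁ := c₁.q_le_rpow hρ hw h₁
  generalize (n + t) / (1 + j) = τ at *
  have hX' := hX.trans (rpow_le_rpow_mul hρ0 (by linarith) s₁ hs)
  have hq : (v₂.q : ℝ) ^ (-s) ≤ ρ ^ (-(τ * s)) := by
    rw [Real.rpow_neg (by linarith), Real.rpow_neg hρ0.le, Real.rpow_mul hρ0.le]
    exact inv_anti₀ (by positivity) (Real.rpow_le_rpow (by positivity) r₂ hs)
  have hY' := hY.le.trans (mul_le_rpow_add hρ0 (by positivity) le_rfl hq)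
  rw [abs_mul]
  refine (mul_le_rpow_add hρ0 (abs_nonneg _) hX' hY').trans
    (Real.rpow_le_rpow_of_exponent_le hρ1 ?_)
  linarith

lemma abs_mul_errors_le (hρ : 2 ^ 250 ≤ ρ) (hw : IsWeight i j) {y₁ y₂ : ℝ}
    (h₁ : v₁.Hits (ρ ^ (-7 : ℝ)) i j √2 y₁) (c₁ : v₁.InClass ρ j n t)
    (h₂ : v₂.Hits (ρ ^ (-7 : ℝ)) i j √2 y₂) (c₂ : v₂.InClass ρ j n t) :
    |v₁.a * (v₂.q * √2 - v₂.p) + v₁.b * (v₂.q * y₂ - v₂.r)| ≤ ρ ^ (-6 + 1 / 100 : ℝ) := by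
  have hi : 0 ≤ i ∧ i ≤ 1 ∧ 0 ≤ j ∧ j ≤ 1 := by
    rcases hw with ⟨rfl, rfl⟩ | ⟨rfl, rfl⟩ <;> norm_num
  obtain ⟨hi0, hi1, hj0, hj1⟩ := hi
  exact (abs_add_le _ _).trans (add_le_rpow hρ
    (abs_mul_error_le hρ hw h₁ c₁ h₂ c₂ hi0 hi1 h₁.a_le h₂.x_near)
    (abs_mul_error_le hρ hw h₁ c₁ h₂ c₂ hj0 hj1 h₁.b_le h₂.y_near))

/-- Two flagged points of the same class that hit nearby points share a line. -/
lemma line_incident_of_close (hρ : 2 ^ 250 ≤ ρ) (hw : IsWeight i j) {y₁ y₂ : ℝ}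
    (h₁ : v₁.Hits (ρ ^ (-7 : ℝ)) i j √2 y₁) (c₁ : v₁.InClass ρ j n t)
    (h₂ : v₂.Hits (ρ ^ (-7 : ℝ)) i j √2 y₂) (c₂ : v₂.InClass ρ j n t)
    (hy : |y₂ - y₁| ≤ ρ ^ (1 - n - 4 : ℝ)) :
    v₁.a * v₂.p + v₁.b * v₂.r + v₁.e * v₂.q = 0 := by
  have hρ0 : 0 < ρ := lt_of_lt_of_le (by positivity) hρ
  have hρ1 : 1 < ρ := lt_of_lt_of_le (by norm_num) hρ
  have hq₂ := h₂.one_le_q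
  have s₂ := c₂.q_le_rpow hρ hw h₂
  have F := c₁.le_rpow_sub hρ hw h₁ (abs_nonneg _)
    (abs_line_le_rpow (k := 1) (z := y₂) hρ h₁ c₁ (by exact_mod_cast hy))
  have E := abs_mul_errors_le hρ hw h₁ c₁ h₂ c₂
  have b₃ : |v₂.q * (v₁.a * √2 + v₁.b * y₂ + v₁.e)| ≤ ρ ^ (-1 / 2 : ℝ) := by
    rw [abs_mul, abs_of_nonneg (by linarith : (0 : ℝ) ≤ v₂.q)]
    refine (mul_le_rpow_add hρ0 (abs_nonneg _) s₂ F).trans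
      (Real.rpow_le_rpow_of_exponent_le hρ1.le ?_)
    push_cast
    linarith
  have e1 : ((v₁.a * v₂.p + v₁.b * v₂.r + v₁.e * v₂.q : ℤ) : ℝ)
      = v₂.q * (v₁.a * √2 + v₁.b * y₂ + v₁.e)
        - (v₁.a * (v₂.q * √2 - v₂.p) + v₁.b * (v₂.q * y₂ - v₂.r)) := by
    push_cast; ring
  refine Int.abs_lt_one_iff.mp ?_
  have : |((v₁.a * v₂.p + v₁.b * v₂.r + v₁.e * v₂.q : ℤ) : ℝ)| < 1 := by
    rw [e1]
    refine (abs_sub _ _).trans_lt ((add_le_rpow hρ b₃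
      (E.trans (Real.rpow_le_rpow_of_exponent_le hρ1.le (by norm_num)))).trans_lt ?_)
    exact Real.rpow_lt_one_of_one_lt_of_neg hρ1 (by norm_num)
  exact_mod_cast this

lemma q_mul_abs_line_le_of_incident (hρ : 2 ^ 250 ≤ ρ) (hw : IsWeight i j) {y₁ y₂ : ℝ}
    (h₁ : v₁.Hits (ρ ^ (-7 : ℝ)) i j √2 y₁) (c₁ : v₁.InClass ρ j n t)
    (h₂ : v₂.Hits (ρ ^ (-7 : ℝ)) i j √2 y₂) (c₂ : v₂.InClass ρ j n t)
    (hinc : v₁.a * v₂.p + v₁.b * v₂.r + v₁.e * v₂.q = 0) :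
    v₁.q * |v₁.a * √2 + v₁.b * y₂ + v₁.e| ≤ ρ ^ (-5 + 1 / 100 : ℝ) := by
  have hρ0 : 0 < ρ := lt_of_lt_of_le (by positivity) hρ
  have hq₂ := h₂.one_le_q
  have hinc' : (v₁.a : ℝ) * v₂.p + v₁.b * v₂.r + v₁.e * v₂.q = 0 := by exact_mod_cast hinc
  have E : v₂.q * |v₁.a * √2 + v₁.b * y₂ + v₁.e| ≤ ρ ^ (-6 + 1 / 100 : ℝ) := by
    convert abs_mul_errors_le hρ hw h₁ c₁ h₂ c₂ using 1
    rw [← abs_of_nonneg (by linarith : (0 : ℝ) ≤ v₂.q), ← abs_mul,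
      abs_of_nonneg (by linarith : (0 : ℝ) ≤ v₂.q)]
    congr 1
    linear_combination hinc'
  convert mul_le_rpow_add hρ0 (abs_nonneg _) (c₁.q_le_rpow hρ hw h₁)
    (c₂.le_rpow_sub hρ hw h₂ (abs_nonneg _) E) using 2
  ring

/-- If two flagged points of the same class share a line, then they hit nearby points only. -/
lemma abs_sub_le_of_incident (hρ : 2 ^ 250 ≤ ρ) (hw : IsWeight i j) {y₁ y₂ : ℝ}
    (h₁ : v₁.Hits (ρ ^ (-7 : ℝ)) i j √2 y₁) (c₁ : v₁.InClass ρ j n t)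
    (h₂ : v₂.Hits (ρ ^ (-7 : ℝ)) i j √2 y₂) (c₂ : v₂.InClass ρ j n t)
    (hinc : v₁.a * v₂.p + v₁.b * v₂.r + v₁.e * v₂.q = 0) :
    |y₁ - y₂| ≤ 1 / ρ ^ (n + 4) := by
  have hρ0 : 0 < ρ := lt_of_lt_of_le (by positivity) hρ
  have hρ1 : 1 ≤ ρ := le_trans (by norm_num) hρ
  have hq₁ := h₁.one_le_q
  have L₁ := q_mul_abs_line_le_of_incident hρ hw h₁ c₁ h₁ c₁ h₁.incident
  have L₂ := q_mul_abs_line_le_of_incident hρ hw h₁ c₁ h₂ c₂ hinc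
  have e1 : |(v₁.b : ℝ)| * |y₁ - y₂| ≤
      |v₁.a * √2 + v₁.b * y₁ + v₁.e| + |v₁.a * √2 + v₁.b * y₂ + v₁.e| := by
    rw [← abs_mul]
    refine le_trans (le_of_eq ?_) (abs_sub _ _)
    congr 1
    ring
  have e2 : v₁.height * |y₁ - y₂| ≤ ρ ^ (-4 : ℝ) := by
    calc v₁.height * |y₁ - y₂| = v₁.q * (|(v₁.b : ℝ)| * |y₁ - y₂|) := mul_assoc _ _ _
      _ ≤ v₁.q * _ := mul_le_mul_of_nonneg_left e1 (by linarith)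
      _ ≤ ρ ^ (-5 + 1 / 100 + 1 / 100 : ℝ) := by
        rw [mul_add]; exact add_le_rpow hρ L₁ L₂
      _ ≤ ρ ^ (-4 : ℝ) := Real.rpow_le_rpow_of_exponent_le hρ1 (by norm_num)
  have e3 : ρ ^ n * |y₁ - y₂| ≤ ρ ^ (-4 : ℝ) :=
    (mul_le_mul_of_nonneg_right c₁.le_height (abs_nonneg _)).trans e2
  have e4 : ρ ^ (-4 : ℝ) = 1 / ρ ^ 4 := by
    rw [Real.rpow_neg hρ0.le, one_div]; norm_cast
  rw [e4, le_div_iff₀ (by positivity)] at e3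
  rw [le_div_iff₀ (by positivity), pow_add]
  linarith

/-- Every hitting flagged point lies in one of few classes. -/
lemma exists_inClass (hρ : 2 ^ 250 ≤ ρ) (hw : IsWeight i j) {c x : ℝ}
    (h : v.Hits c i j x y) (hn : ρ ^ n ≤ v.height) (hn1 : v.height < ρ ^ (n + 1)) :
    ∃ t < n + 2, v.InClass ρ j n t := by
  have hρ1 : 1 < ρ := lt_of_lt_of_le (by norm_num) hρ
  have hρ0 : 0 < ρ := by linarith
  have hj : 0 ≤ j ∧ 3 * j ≤ 2 := by rcases hw with ⟨rfl, rfl⟩ | ⟨rfl, rfl⟩ <;> norm_num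
  have hq := h.one_le_q
  obtain ⟨N, hN, hN1⟩ := exists_nat_pow_near (Real.one_le_rpow hq (by linarith : 0 ≤ 1 + j)) hρ1
  have h1 : n < N + 1 := (pow_lt_pow_iff_right₀ hρ1).mp ((hn.trans h.height_le).trans_lt hN1)
  obtain ⟨t, rfl⟩ := Nat.exists_eq_add_of_le (Nat.lt_succ_iff.mp h1)
  refine ⟨t, ?_, hn, hn1, hN, hN1⟩
  have h2 : (v.q : ℝ) < ρ ^ ((n + 1 : ℕ) : ℝ) := by
    rw [Real.rpow_natCast]; exact h.q_le_height.trans_lt hn1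
  have h3 := hN.trans_lt (Real.rpow_lt_rpow (by linarith) h2 (by linarith : 0 < 1 + j))
  rw [← Real.rpow_natCast, ← Real.rpow_mul hρ0.le, Real.rpow_lt_rpow_left_iff hρ1] at h3
  have h4 : (t : ℝ) < n + 2 := by
    push_cast at h3
    nlinarith [hj.1, hj.2]
  exact_mod_cast h4

end Class

end FlaggedPoint

/-- The `a`-th interval of length `R ^ -(l + 3)`. -/
def cell (R l a : ℕ) : Set ℝ :=
  Set.Icc ((a : ℝ) / (R : ℝ) ^ (l + 3)) ((a + 1 : ℝ) / (R : ℝ) ^ (l + 3))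

/-- No flagged point of height less than `R ^ l` hits `y`, for either pair of exponents. -/
def AvoidsBelow (R l : ℕ) (y : ℝ) : Prop :=
  ∀ i j : ℝ, IsWeight i j → ∀ v : FlaggedPoint,
    v.Hits ((R : ℝ) ^ (-7 : ℝ)) i j √2 y → (R : ℝ) ^ l ≤ v.height

/-- The indices of the cells obtained by dividing those with indices in `T` into `R` pieces. -/
def children (R : ℕ) (T : Finset ℕ) : Finset ℕ :=
  (T ×ˢ Finset.range R).image fun z => R * z.1 + z.2

open Classical in
/-- The indices of the cells that survive at level `l`. -/
noncomputable def survivors (R : ℕ) : ℕ → Finset ℕ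
  | 0 => {0}
  | l + 1 => (children R (survivors R l)).filter fun a => ∀ y ∈ cell R (l + 1) a,
      AvoidsBelow R (l + 1) y

section Cells

variable {R l k a : ℕ}

lemma mem_survivors_succ : a ∈ survivors R (l + 1) ↔
    a ∈ children R (survivors R l) ∧ ∀ y ∈ cell R (l + 1) a, AvoidsBelow R (l + 1) y := by
  classical
  rw [survivors, Finset.mem_filter]

lemma mem_children (hR : 0 < R) {T : Finset ℕ} : a ∈ children R T ↔ a / R ∈ T := by
  simp only [children, Finset.mem_image, Finset.mem_product, Finset.mem_range, Prod.exists]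
  constructor
  · rintro ⟨b, d, ⟨hb, hd⟩, rfl⟩
    rwa [Nat.mul_add_div hR, Nat.div_eq_of_lt hd, add_zero]
  · intro h
    exact ⟨a / R, a % R, ⟨h, Nat.mod_lt _ hR⟩, Nat.div_add_mod a R⟩

lemma card_children (hR : 0 < R) (T : Finset ℕ) : (children R T).card = R * T.card := by
  rw [children, Finset.card_image_of_injOn, Finset.card_product, Finset.card_range, mul_comm]
  rintro ⟨b, d⟩ h ⟨b', d'⟩ h' heq
  simp only [Finset.coe_product, Set.mem_prod, Finset.mem_coe, Finset.mem_range] at h h' heq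
  have h1 := congrArg (· / R) heq
  have h2 := congrArg (· % R) heq
  simp only [Nat.mul_add_div hR, Nat.mul_add_mod, Nat.div_eq_of_lt, h.2, h'.2, Nat.mod_eq_of_lt,
    add_zero] at h1 h2
  rw [h1, h2]

lemma cell_succ_subset (hR : 0 < R) : cell R (l + 1) a ⊆ cell R l (a / R) := by
  have hR' : (0 : ℝ) < R := by exact_mod_cast hR
  have hpow : (R : ℝ) ^ (l + 1 + 3) = R * (R : ℝ) ^ (l + 3) := by ring
  have h1 : (R : ℝ) * (a / R : ℕ) ≤ a := by exact_mod_cast Nat.mul_div_le a R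
  have h2 : (a : ℝ) + 1 ≤ R * ((a / R : ℕ) + 1) := by
    exact_mod_cast Nat.lt_mul_div_succ a hR
  apply Set.Icc_subset_Icc
  · rw [hpow, ← div_div, div_le_div_iff_of_pos_right (by positivity), le_div_iff₀' hR']
    exact h1
  · rw [hpow, ← div_div, div_le_div_iff_of_pos_right (by positivity), div_le_iff₀' hR']
    exact h2

lemma cell_add_subset (hR : 0 < R) : cell R (l + k) a ⊆ cell R l (a / R ^ k) := by
  induction k generalizing a with
  | zero => simp
  | succ k ih =>
    rw [← add_assoc, pow_succ', ← Nat.div_div_eq_div_mul]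
    exact (cell_succ_subset hR).trans ih

lemma abs_sub_le_of_mem_cell {y z : ℝ} (hy : y ∈ cell R l a) (hz : z ∈ cell R l a) :
    |z - y| ≤ 1 / (R : ℝ) ^ (l + 3) := by
  obtain ⟨h1, h2⟩ := hy
  obtain ⟨h3, h4⟩ := hz
  rw [add_div] at h2 h4
  rw [abs_le]
  constructor <;> linarith

lemma le_add_two_of_mem_cell (hR : 0 < R) {b : ℕ} {y z : ℝ} (hy : y ∈ cell R l a)
    (hz : z ∈ cell R l b) (h : |y - z| ≤ 1 / (R : ℝ) ^ (l + 3)) : b ≤ a + 2 := by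
  have hR' : (0 : ℝ) < R := by exact_mod_cast hR
  have h1 : (b : ℝ) / (R : ℝ) ^ (l + 3) ≤ (a + 1 + 1) / (R : ℝ) ^ (l + 3) := by
    rw [add_div (a + 1 : ℝ)]
    linarith [hz.1, hy.2, neg_le_of_abs_le h]
  rw [div_le_div_iff_of_pos_right (by positivity)] at h1
  exact_mod_cast h1.trans_eq (by ring : (a + 1 + 1 : ℝ) = a + 2)

lemma survivors_div_mem (hR : 0 < R) (ha : a ∈ survivors R (l + k)) :
    a / R ^ k ∈ survivors R l := by
  induction k generalizing a with
  | zero => simpa using ha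
  | succ k ih =>
    rw [← add_assoc, mem_survivors_succ, mem_children hR] at ha
    rw [pow_succ', ← Nat.div_div_eq_div_mul]
    exact ih ha.1

lemma avoidsBelow_of_mem_survivors (ha : a ∈ survivors R l) {y : ℝ} (hy : y ∈ cell R l a) :
    AvoidsBelow R l y := by
  cases l with
  | zero =>
    intro i j _ v hv
    rw [pow_zero]
    exact hv.one_le_q.trans hv.q_le_height
  | succ l =>
    exact (mem_survivors_succ.mp ha).2 y hy

end Cells

lemma card_le_three_of_forall_le_add_two (s : Finset ℕ) (h : ∀ a ∈ s, ∀ b ∈ s, b ≤ a + 2) :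
    s.card ≤ 3 := by
  rcases s.eq_empty_or_nonempty with rfl | hs
  · simp
  · have : s ⊆ Finset.Icc (s.min' hs) (s.min' hs + 2) := fun b hb =>
      Finset.mem_Icc.mpr ⟨s.min'_le b hb, h _ (s.min'_mem hs) b hb⟩
    refine (Finset.card_le_card this).trans ?_
    rw [Nat.card_Icc]
    omega

section Counting

variable {R n t : ℕ} {i j : ℝ}

/-- Inside a surviving cell, the flagged points of one class destroy at most three cells. -/
lemma card_hit_children_le (hR : 2 ^ 250 ≤ R) (hw : IsWeight i j) {k : ℕ}
    (hk : k = max 1 (t / 100)) (hkn : k ≤ n + 1) {I : ℕ} (hI : I ∈ survivors R (n + 1 - k))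
    (s : Finset ℕ) (hs : ∀ a ∈ s, a / R ^ k = I ∧ ∃ y ∈ cell R (n + 1) a, ∃ v : FlaggedPoint,
      v.Hits ((R : ℝ) ^ (-7 : ℝ)) i j √2 y ∧ v.InClass (R : ℝ) j n t) : s.card ≤ 3 := by
  have hR0 : 0 < R := lt_of_lt_of_le (by positivity) hR
  have hρ : (2 : ℝ) ^ 250 ≤ R := by exact_mod_cast hR
  have hρ0 : (0 : ℝ) < R := by exact_mod_cast hR0
  refine card_le_three_of_forall_le_add_two s fun a ha b hb => ?_
  obtain ⟨haI, y, hy, v, hv, cv⟩ := hs a ha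
  obtain ⟨hbI, z, hz, w, hw', cw⟩ := hs b hb
  have hyI : y ∈ cell R (n + 1 - k) I := by
    rw [← haI]; apply cell_add_subset hR0; rwa [Nat.sub_add_cancel hkn]
  have hzI : z ∈ cell R (n + 1 - k) I := by
    rw [← hbI]; apply cell_add_subset hR0; rwa [Nat.sub_add_cancel hkn]
  have hyz : |z - y| ≤ (R : ℝ) ^ (k - n - 4 : ℝ) := by
    refine (abs_sub_le_of_mem_cell hyI hzI).trans_eq ?_
    rw [one_div, ← Real.rpow_natCast, ← Real.rpow_neg hρ0.le]
    congr 1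
    push_cast [Nat.cast_sub hkn]
    ring
  refine le_add_two_of_mem_cell hR0 hy hz
    (FlaggedPoint.abs_sub_le_of_incident hρ hw hv cv hw' cw ?_)
  by_cases ht : 100 ≤ t
  · have hk1 : 1 ≤ k := by omega
    refine FlaggedPoint.line_incident_of_large_index (k := k) hρ hw (by omega) hk1 ?_
      hv cv hw' cw hyz (by simpa using by positivity)
    intro u hu
    have := avoidsBelow_of_mem_survivors hI hzI i j hw u hu
    rw [← Real.rpow_natCast, Nat.cast_sub hkn] at this
    exact_mod_cast this
  · have hk1 : k = 1 := by omega
    exact FlaggedPoint.line_incident_of_close hρ hw hv cv hw' cw (by simpa [hk1] using hyz)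

lemma card_children_hit_le (hR : 2 ^ 250 ≤ R) (hw : IsWeight i j) (s : Finset ℕ)
    (hs : s ⊆ children R (survivors R n))
    (hhit : ∀ a ∈ s, ∃ y ∈ cell R (n + 1) a, ∃ v : FlaggedPoint,
      v.Hits ((R : ℝ) ^ (-7 : ℝ)) i j √2 y ∧ v.height < (R : ℝ) ^ (n + 1)) :
    s.card ≤ 3 * ∑ t ∈ Finset.range (n + 2), (survivors R (n + 1 - max 1 (t / 100))).card := by
  classical
  have hR0 : 0 < R := lt_of_lt_of_le (by positivity) hR
  have hρ : (2 : ℝ) ^ 250 ≤ R := by exact_mod_cast hR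
  let hit (t I : ℕ) : Finset ℕ := s.filter fun a => a / R ^ max 1 (t / 100) = I ∧
    ∃ y ∈ cell R (n + 1) a, ∃ v : FlaggedPoint,
      v.Hits ((R : ℝ) ^ (-7 : ℝ)) i j √2 y ∧ v.InClass (R : ℝ) j n t
  have hcover : s ⊆ (Finset.range (n + 2)).biUnion fun t =>
      (survivors R (n + 1 - max 1 (t / 100))).biUnion (hit t) := by
    intro a ha
    obtain ⟨y, hy, v, hv, hlt⟩ := hhit a ha
    have hpar := (mem_children hR0).mp (hs ha)
    have hge := avoidsBelow_of_mem_survivors hpar (cell_succ_subset hR0 hy) i j hw v hv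
    obtain ⟨t, ht, hc⟩ := FlaggedPoint.exists_inClass hρ hw hv hge hlt
    simp only [Finset.mem_biUnion, Finset.mem_range]
    refine ⟨t, ht, a / R ^ max 1 (t / 100), ?_, Finset.mem_filter.mpr ⟨ha, rfl, y, hy, v, hv, hc⟩⟩
    obtain ⟨m, hm⟩ : ∃ m, max 1 (t / 100) = m + 1 := ⟨max 1 (t / 100) - 1, by omega⟩
    rw [hm, pow_succ', ← Nat.div_div_eq_div_mul]
    apply survivors_div_mem hR0
    rwa [show n + 1 - (m + 1) + m = n by omega]
  refine (Finset.card_le_card hcover).trans (Finset.card_biUnion_le.trans ?_)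
  rw [Finset.mul_sum]
  refine Finset.sum_le_sum fun t ht => ?_
  rw [mul_comm]
  refine Finset.card_biUnion_le_card_mul _ _ _ fun I hI => ?_
  rw [Finset.mem_range] at ht
  exact card_hit_children_le hR hw rfl (by omega) hI _ fun a ha => (Finset.mem_filter.mp ha).2

lemma mul_card_survivors_le (hR : 2 ^ 250 ≤ R) (n : ℕ) :
    R * (survivors R n).card ≤ (survivors R (n + 1)).card +
      6 * ∑ t ∈ Finset.range (n + 2), (survivors R (n + 1 - max 1 (t / 100))).card := by
  classical
  have hR0 : 0 < R := lt_of_lt_of_le (by positivity) hR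
  let hit (i j : ℝ) : Finset ℕ := (children R (survivors R n)).filter fun a =>
    ∃ y ∈ cell R (n + 1) a, ∃ v : FlaggedPoint,
      v.Hits ((R : ℝ) ^ (-7 : ℝ)) i j √2 y ∧ v.height < (R : ℝ) ^ (n + 1)
  have hcover : children R (survivors R n) ⊆
      survivors R (n + 1) ∪ (hit (1 / 3) (2 / 3) ∪ hit (2 / 3) (1 / 3)) := by
    intro a ha
    by_cases hmem : a ∈ survivors R (n + 1)
    · exact Finset.mem_union_left _ hmem
    · apply Finset.mem_union_right
      rw [mem_survivors_succ] at hmem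
      simp only [ha, true_and, AvoidsBelow] at hmem
      push Not at hmem
      obtain ⟨y, hy, i, j, hw, v, hv, hlt⟩ := hmem
      rcases hw with ⟨rfl, rfl⟩ | ⟨rfl, rfl⟩
      · exact Finset.mem_union_left _ (Finset.mem_filter.mpr ⟨ha, y, hy, v, hv, hlt⟩)
      · exact Finset.mem_union_right _ (Finset.mem_filter.mpr ⟨ha, y, hy, v, hv, hlt⟩)
  have hhit : ∀ i j, IsWeight i j → (hit i j).card ≤ _ := fun i j hw =>
    card_children_hit_le hR hw (hit i j) (Finset.filter_subset _ _)
      fun a ha => (Finset.mem_filter.mp ha).2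
  have h1 := hhit _ _ (Or.inl ⟨rfl, rfl⟩)
  have h2 := hhit _ _ (Or.inr ⟨rfl, rfl⟩)
  have h3 := (Finset.card_le_card hcover).trans (Finset.card_union_le _ _)
  have h4 := Finset.card_union_le (hit (1 / 3) (2 / 3)) (hit (2 / 3) (1 / 3))
  rw [card_children hR0] at h3
  omega

end Counting

lemma growth_of_recurrence {R : ℕ} (hR : 2 ^ 250 ≤ R) {N : ℕ → ℕ}
    (h : ∀ n, R * N n ≤ N (n + 1) +
      6 * ∑ t ∈ Finset.range (n + 2), N (n + 1 - max 1 (t / 100))) (n : ℕ) :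
    2 ^ 100 * N n ≤ N (n + 1) := by
  induction n using Nat.strong_induction_on with
  | _ n ih =>
  have hgrow : ∀ d m, m + d ≤ n → 2 ^ (100 * d) * N m ≤ N (m + d) := by
    intro d m
    induction d with
    | zero => simp
    | succ d ihd =>
      intro hd
      calc 2 ^ (100 * (d + 1)) * N m = 2 ^ 100 * (2 ^ (100 * d) * N m) := by ring
        _ ≤ 2 ^ 100 * N (m + d) := Nat.mul_le_mul_left _ (ihd (by omega))
        _ ≤ N (m + (d + 1)) := ih (m + d) (by omega)
  have hterm : ∀ t ∈ Finset.range (n + 2),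
      (N (n + 1 - max 1 (t / 100)) : ℝ) ≤ 2 ^ 200 * N n * (1 / 2) ^ t := by
    intro t ht
    rw [Finset.mem_range] at ht
    obtain ⟨d, hd⟩ : ∃ d, max 1 (t / 100) = d + 1 := ⟨max 1 (t / 100) - 1, by omega⟩
    have h1 := hgrow d (n - d) (by omega)
    rw [show n - d + d = n by omega] at h1
    rw [hd, show n + 1 - (d + 1) = n - d by omega, one_div, inv_pow, ← div_eq_mul_inv,
      le_div_iff₀ (by positivity)]
    have h2 : 2 ^ t * N (n - d) ≤ 2 ^ 200 * N n := by
      calc 2 ^ t * N (n - d) ≤ 2 ^ (200 + 100 * d) * N (n - d) :=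
            Nat.mul_le_mul_right _ (Nat.pow_le_pow_right (by norm_num) (by omega))
        _ = 2 ^ 200 * (2 ^ (100 * d) * N (n - d)) := by rw [pow_add, mul_assoc]
        _ ≤ 2 ^ 200 * N n := Nat.mul_le_mul_left _ h1
    rw [mul_comm]
    exact_mod_cast h2
  have hsum : (∑ t ∈ Finset.range (n + 2), (N (n + 1 - max 1 (t / 100)) : ℝ))
      ≤ 2 ^ 200 * N n * 2 := by
    refine (Finset.sum_le_sum hterm).trans ?_
    rw [← Finset.mul_sum]
    gcongr
    exact (summable_geometric_two.sum_le_tsum _ fun _ _ => by positivity).trans_eq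
      tsum_geometric_two
  have hn : (R : ℝ) * N n ≤ N (n + 1) +
      6 * ∑ t ∈ Finset.range (n + 2), (N (n + 1 - max 1 (t / 100)) : ℝ) := by
    exact_mod_cast h n
  have hRn : (2 : ℝ) ^ 250 * N n ≤ R * N n := by
    have : (2 : ℝ) ^ 250 ≤ R := by exact_mod_cast hR
    gcongr
  have : (2 : ℝ) ^ 100 * N n ≤ N (n + 1) := by
    have : (0 : ℝ) ≤ N n := by positivity
    norm_num at *
    linarith
  exact_mod_cast this

lemma survivors_nonempty {R : ℕ} (hR : 2 ^ 250 ≤ R) (n : ℕ) : (survivors R n).Nonempty := by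
  induction n with
  | zero => simp [survivors]
  | succ n ih =>
    have h := growth_of_recurrence hR (mul_card_survivors_le hR) n
    have := ih.card_pos
    exact Finset.card_pos.mp (by omega)

lemma exists_forall_avoidsBelow {R : ℕ} (hR : 2 ^ 250 ≤ R) : ∃ y, ∀ l, AvoidsBelow R l y := by
  have hR0 : 0 < R := lt_of_lt_of_le (by positivity) hR
  let E (l : ℕ) : Set ℝ := ⋃ a ∈ survivors R l, cell R l a
  have hcompact : ∀ l, IsCompact (E l) := fun l =>
    (survivors R l).isCompact_biUnion fun a _ => isCompact_Icc
  obtain ⟨y, hy⟩ := IsCompact.nonempty_iInter_of_sequence_nonempty_isCompact_isClosed E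
    (fun l => Set.iUnion₂_subset fun a ha => by
      have := survivors_div_mem (k := 1) hR0 ha
      rw [pow_one] at this
      exact (cell_succ_subset hR0).trans
        (Set.subset_biUnion_of_mem (u := cell R l) (Finset.mem_coe.mpr this)))
    (fun l => by
      obtain ⟨a, ha⟩ := survivors_nonempty hR l
      refine ⟨(a : ℝ) / (R : ℝ) ^ (l + 3), Set.mem_biUnion ha ⟨le_rfl, ?_⟩⟩
      gcongr
      linarith)
    (hcompact 0) (fun l => (hcompact l).isClosed)
  refine ⟨y, fun l => ?_⟩
  obtain ⟨a, ha, hya⟩ := Set.mem_iUnion₂.mp (Set.mem_iInter.mp hy l)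
  exact avoidsBelow_of_mem_survivors ha hya

lemma mem_badPair_of_forall_not_hits {c i j y : ℝ} (hc0 : 0 < c) (hc : c ≤ 1 / 4) (hi1 : i ≤ 1)
    (hij : i + j = 1) (h : ∀ v : FlaggedPoint, ¬ v.Hits c i j √2 y) :
    (√2, y) ∈ badPair i j := by
  refine lt_of_lt_of_le hc0 (le_ciInf fun q => ?_)
  by_contra! hlt
  have hq0 : (0 : ℝ) < (q : ℕ) := by exact_mod_cast q.pos
  have hdist : ∀ {z s : ℝ}, ((q : ℕ) : ℝ) ^ s * distNearestInt z < c →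
      |z - round z| < c * ((q : ℕ) : ℝ) ^ (-s) := by
    intro z s hz
    rwa [Real.rpow_neg hq0.le, ← div_eq_mul_inv, lt_div_iff₀' (by positivity)]
  obtain ⟨v, -, hv⟩ := exists_hits (q := ((q : ℕ) : ℤ)) (y := y) hc hi1 hij
    (by exact_mod_cast q.pos) (by simpa using hdist ((le_max_left _ _).trans_lt hlt))
    (by simpa using hdist ((le_max_right _ _).trans_lt hlt))
  exact h v hv

/-- **Schmidt's conjecture**: `Bad(1/3, 2/3) ∩ Bad(2/3, 1/3)` is nonempty. -/
theorem schmidt_conjecture :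
    (badPair (1/3) (2/3) ∩ badPair (2/3) (1/3)).Nonempty := by
  obtain ⟨R, hR⟩ : ∃ R : ℕ, 2 ^ 250 ≤ R := ⟨_, le_rfl⟩
  have hρ : (2 : ℝ) ^ 250 ≤ R := by exact_mod_cast hR
  have hρ0 : (0 : ℝ) < R := lt_of_lt_of_le (by positivity) hρ
  have hρ1 : (1 : ℝ) < R := lt_of_lt_of_le (by norm_num) hρ
  obtain ⟨y, hy⟩ := exists_forall_avoidsBelow hR
  have hnot : ∀ i j, IsWeight i j →
      ∀ v : FlaggedPoint, ¬ v.Hits ((R : ℝ) ^ (-7 : ℝ)) i j √2 y := by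
    intro i j hw v hv
    obtain ⟨l, hl⟩ := pow_unbounded_of_one_lt v.height hρ1
    exact (hy l i j hw v hv).not_gt hl
  exact ⟨(√2, y),
    mem_badPair_of_forall_not_hits (by positivity) (rpow_neg_seven_le hρ) (by norm_num)
      (by norm_num) (hnot _ _ (Or.inl ⟨rfl, rfl⟩)),
    mem_badPair_of_forall_not_hits (by positivity) (rpow_neg_seven_le hρ) (by norm_num)
      (by norm_num) (hnot _ _ (Or.inr ⟨rfl, rfl⟩))⟩
end

section
/- For all real numbers s, t ≥ 0 with s + t = 1, the set Bad(s,t) has full Hausdorff dimension in ℝ²: dim_H(Bad(s,t)) = 2. -/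
open Metric Filter

/-- Grid points within bounded distance of the graph of a `1`-Lipschitz affine function are few. -/
lemma card_near_graph_le {k m : ℝ} (hk : |k| ≤ 1) {N : ℕ} {G : Finset (ℕ × ℕ)}
    (hG : ∀ p ∈ G, p.1 < N ∧ ∃ ξ : ℝ, |ξ - p.1| ≤ 2 ∧ |k * ξ + m - p.2| ≤ 2) :
    G.card ≤ 9 * N := by
  have key := Finset.card_le_mul_card_image_of_maps_to (f := Prod.fst) (s := G)
    (t := Finset.range N) (fun p hp => Finset.mem_range.2 (hG p hp).1) 9 ?_
  · simpa using key
  intro i _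
  set z : ℝ := k * i + m with hz
  have hle : (G.filter fun p => p.1 = i).card ≤ (Finset.Icc ⌈z - 4⌉ ⌊z + 4⌋).card := by
    refine Finset.card_le_card_of_injOn (fun p => (p.2 : ℤ)) ?_ ?_
    · intro p hp
      obtain ⟨hpG, rfl⟩ := Finset.mem_filter.1 hp
      obtain ⟨_, ξ, h1, h2⟩ := hG p hpG
      have h3 : |k * (ξ - p.1)| ≤ 2 := by
        rw [abs_mul]
        nlinarith [abs_nonneg k, abs_nonneg (ξ - p.1)]
      rw [abs_le] at h2 h3
      simp only [Finset.coe_Icc, Set.mem_Icc, Int.ceil_le, Int.le_floor, Int.cast_natCast]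
      constructor <;> nlinarith
    · intro p hp p' hp' h
      have h1 := (Finset.mem_filter.1 hp).2
      have h2 := (Finset.mem_filter.1 hp').2
      simp only [Nat.cast_inj] at h
      exact Prod.ext (h1.trans h2.symm) h
  refine hle.trans ?_
  rw [Int.card_Icc]
  have h1 := Int.floor_le (z + 4)
  have h2 := Int.le_ceil (z - 4)
  have h3 : (⌊z + 4⌋ : ℝ) ≤ ⌈z - 4⌉ + 8 := by linarith
  have h4 : ⌊z + 4⌋ ≤ ⌈z - 4⌉ + 8 := by exact_mod_cast h3
  omega

/-- A planar set all of whose triples are collinear lies on a line. -/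
lemma exists_line_of_collinear_triples {S : Set (ℝ × ℝ)}
    (hS : ∀ p ∈ S, ∀ q ∈ S, ∀ r ∈ S,
      (q.1 - p.1) * (r.2 - p.2) = (r.1 - p.1) * (q.2 - p.2)) :
    ∃ A B C : ℝ, (A ≠ 0 ∨ B ≠ 0) ∧ ∀ p ∈ S, A * p.1 + B * p.2 = C := by
  by_cases h : ∃ p ∈ S, ∃ q ∈ S, p ≠ q
  · obtain ⟨p, hp, q, hq, hpq⟩ := h
    refine ⟨q.2 - p.2, p.1 - q.1, (q.2 - p.2) * p.1 + (p.1 - q.1) * p.2, ?_, ?_⟩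
    · by_contra! hne
      exact hpq (Prod.ext (by linarith [hne.2]) (by linarith [hne.1]))
    · intro r hr
      linarith [hS p hp q hq r hr]
  · push Not at h
    rcases S.eq_empty_or_nonempty with rfl | ⟨p, hp⟩
    · exact ⟨1, 0, 0, by simp, by simp⟩
    · exact ⟨1, 0, p.1, by simp, fun r hr => by rw [h r hr p hp]; ring⟩

/-- Grid points within bounded distance of a collinear set are few. -/
lemma card_near_collinear_le {S : Set (ℝ × ℝ)}
    (hS : ∀ p ∈ S, ∀ q ∈ S, ∀ r ∈ S,
      (q.1 - p.1) * (r.2 - p.2) = (r.1 - p.1) * (q.2 - p.2))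
    {N M : ℕ} {G : Finset (ℕ × ℕ)}
    (hG : ∀ p ∈ G, p.1 < N ∧ p.2 < M ∧ ∃ z ∈ S, |z.1 - p.1| ≤ 2 ∧ |z.2 - p.2| ≤ 2) :
    G.card ≤ 9 * max N M := by
  obtain ⟨A, B, C, hAB, hline⟩ := exists_line_of_collinear_triples hS
  rcases le_total |A| |B| with h | h
  · have hB : B ≠ 0 := by
      rintro rfl
      simp only [abs_zero, abs_nonpos_iff] at h
      simp [h] at hAB
    refine (card_near_graph_le (k := -A / B) (m := C / B) (N := N) ?_ ?_).trans (by gcongr; simp)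
    · rw [abs_div, abs_neg]
      exact div_le_one_of_le₀ h (abs_nonneg _)
    · intro p hp
      obtain ⟨h1, _, z, hz, h3, h4⟩ := hG p hp
      refine ⟨h1, z.1, h3, ?_⟩
      have : -A / B * z.1 + C / B = z.2 := by
        rw [← hline z hz]; field_simp; ring
      rwa [this]
  · have hA : A ≠ 0 := by
      rintro rfl
      simp only [abs_zero, abs_nonpos_iff] at h
      simp [h] at hAB
    rw [← Finset.card_map (Equiv.prodComm ℕ ℕ).toEmbedding]
    refine (card_near_graph_le (k := -B / A) (m := C / A) (N := M) ?_ ?_).trans (by gcongr; simp)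
    · rw [abs_div, abs_neg]
      exact div_le_one_of_le₀ h (abs_nonneg _)
    · intro p' hp'
      obtain ⟨p, hp, rfl⟩ := Finset.mem_map.1 hp'
      obtain ⟨_, h1, z, hz, h3, h4⟩ := hG p hp
      refine ⟨h1, z.2, h4, ?_⟩
      have : -B / A * z.2 + C / A = z.1 := by
        rw [← hline z hz]; field_simp; ring
      rw [this]
      exact h3

/-- Three rational points of small height lying in a small box are collinear. -/
lemma rational_points_collinear {a₁ a₂ a₃ b₁ b₂ b₃ : ℤ} {q₁ q₂ q₃ : ℕ} {U V Q : ℝ}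
    (h₁ : 0 < q₁) (h₂ : 0 < q₂) (h₃ : 0 < q₃)
    (hQ₁ : (q₁ : ℝ) ≤ Q) (hQ₂ : (q₂ : ℝ) ≤ Q) (hQ₃ : (q₃ : ℝ) ≤ Q)
    (hU₂ : |(a₂ : ℝ) / q₂ - a₁ / q₁| ≤ U) (hU₃ : |(a₃ : ℝ) / q₃ - a₁ / q₁| ≤ U)
    (hV₂ : |(b₂ : ℝ) / q₂ - b₁ / q₁| ≤ V) (hV₃ : |(b₃ : ℝ) / q₃ - b₁ / q₁| ≤ V)
    (h : 2 * (U * V) * Q ^ 3 < 1) :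
    ((a₂ : ℝ) / q₂ - a₁ / q₁) * ((b₃ : ℝ) / q₃ - b₁ / q₁) =
      ((a₃ : ℝ) / q₃ - a₁ / q₁) * ((b₂ : ℝ) / q₂ - b₁ / q₁) := by
  have p₁ : (0 : ℝ) < q₁ := by exact_mod_cast h₁
  have p₂ : (0 : ℝ) < q₂ := by exact_mod_cast h₂
  have p₃ : (0 : ℝ) < q₃ := by exact_mod_cast h₃
  set D : ℤ := q₁ * (a₂ * b₃ - a₃ * b₂) + q₂ * (a₃ * b₁ - a₁ * b₃) + q₃ * (a₁ * b₂ - a₂ * b₁)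
    with hD
  set u := (a₂ : ℝ) / q₂ - a₁ / q₁ with hu
  set v := (b₃ : ℝ) / q₃ - b₁ / q₁ with hv
  set u' := (a₃ : ℝ) / q₃ - a₁ / q₁ with hu'
  set v' := (b₂ : ℝ) / q₂ - b₁ / q₁ with hv'
  have hdet : (D : ℝ) = (u * v - u' * v') * (q₁ * q₂ * q₃) := by
    rw [hD, hu, hv, hu', hv']
    push_cast
    field_simp
    ring
  have hU : 0 ≤ U := (abs_nonneg _).trans hU₂
  have hV : 0 ≤ V := (abs_nonneg _).trans hV₂
  have huv : |u * v - u' * v'| ≤ 2 * (U * V) := by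
    have e1 : |u * v| ≤ U * V := by rw [abs_mul]; gcongr
    have e2 : |u' * v'| ≤ U * V := by rw [abs_mul]; gcongr
    linarith [abs_sub (u * v) (u' * v')]
  have hq : (q₁ : ℝ) * q₂ * q₃ ≤ Q ^ 3 := by
    have hQ : 0 ≤ Q := p₁.le.trans hQ₁
    calc (q₁ : ℝ) * q₂ * q₃ ≤ Q * Q * Q := by gcongr
      _ = Q ^ 3 := by ring
  have hlt : |(D : ℝ)| < 1 := by
    rw [hdet, abs_mul, abs_of_pos (mul_pos (mul_pos p₁ p₂) p₃)]
    refine lt_of_le_of_lt ?_ h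
    gcongr
  have hD0 : D = 0 := by
    rw [← Int.cast_abs] at hlt
    exact Int.abs_lt_one_iff.1 (by exact_mod_cast hlt)
  rw [hD0, Int.cast_zero] at hdet
  have := (mul_eq_zero.1 hdet.symm).resolve_right (by positivity)
  linarith

/-- No point of `I × J` is close, in the `(s,t)`-weighted sense with constant `c`, to a rational
point whose denominator lies in `[lo, hi)`. -/
def AvoidsRationals (s t c lo hi : ℝ) (I J : Set ℝ) : Prop :=
  ∀ q : ℕ, 0 < q → lo ≤ q → (q : ℝ) < hi → ∀ a b : ℤ, ∀ X ∈ I, ∀ Y ∈ J,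
    c < (q : ℝ) ^ s * |q * X - a| ∨ c < (q : ℝ) ^ t * |q * Y - b|

lemma abs_sub_div_le_of_rpow_mul_le {s c w X : ℝ} {q : ℕ} {a : ℤ} (hq : 0 < q) (hw : 0 < w)
    (hwq : w ≤ (q : ℝ) ^ (1 + s)) (h : (q : ℝ) ^ s * |q * X - a| ≤ c) :
    |(a : ℝ) / q - X| ≤ c / w := by
  have hq' : (0 : ℝ) < q := by exact_mod_cast hq
  have e : (q : ℝ) ^ s * |q * X - a| = (q : ℝ) ^ (1 + s) * |(a : ℝ) / q - X| := by
    rw [Real.rpow_add hq', Real.rpow_one, abs_sub_comm]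
    have : |(a : ℝ) - q * X| = q * |(a : ℝ) / q - X| := by
      rw [← abs_of_pos hq', ← abs_mul, abs_of_pos hq']
      congr 1
      field_simp
    rw [this]; ring
  rw [le_div_iff₀ hw]
  calc |(a : ℝ) / q - X| * w ≤ |(a : ℝ) / q - X| * (q : ℝ) ^ (1 + s) := by gcongr
    _ ≤ c := by rw [mul_comm, ← e]; exact h

lemma pow_le_rpow_of_pow_le {R s q : ℝ} (hR : 0 < R) (hs : 0 ≤ s) {n : ℕ} (hq : R ^ n ≤ q) :
    (R ^ (1 + s)) ^ n ≤ q ^ (1 + s) := by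
  calc (R ^ (1 + s)) ^ n = (R ^ n) ^ (1 + s) := by
        rw [← Real.rpow_natCast, ← Real.rpow_mul hR.le, mul_comm, Real.rpow_mul hR.le,
          Real.rpow_natCast]
    _ ≤ q ^ (1 + s) := by gcongr

/-- In the subdivision of a rectangle, all children but a few avoid the rational points whose
denominators are of the corresponding size. -/
lemma card_not_avoidsRationals_le {R s t ρ σ l c : ℝ} (hs : 0 ≤ s) (ht : 0 ≤ t)
    (hR : 40 ≤ R) (hρ : ρ = R ^ (1 + s)) (hσ : σ = R ^ (1 + t)) (hρσ : ρ * σ = R ^ 3)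
    (hρR : ρ ≤ R ^ 2) (hσR : σ ≤ R ^ 2) (hl : l = 1 / (5 * R ^ 2)) (hc : c = l / R ^ 2)
    (n : ℕ) (x y : ℝ) {G : Finset (ℕ × ℕ)}
    (hG : ∀ p ∈ G, p.1 < ⌊ρ⌋₊ ∧ p.2 < ⌊σ⌋₊ ∧ ¬ AvoidsRationals s t c (R ^ n) (R ^ (n + 1))
      (Set.Icc (x + p.1 * (l / ρ ^ (n + 1))) (x + p.1 * (l / ρ ^ (n + 1)) + l / ρ ^ (n + 1)))
      (Set.Icc (y + p.2 * (l / σ ^ (n + 1))) (y + p.2 * (l / σ ^ (n + 1)) + l / σ ^ (n + 1)))) :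
    G.card ≤ 9 * max ⌊ρ⌋₊ ⌊σ⌋₊ := by
  have hR0 : 0 < R := by linarith
  have hρ0 : 0 < ρ := by rw [hρ]; positivity
  have hσ0 : 0 < σ := by rw [hσ]; positivity
  have hl0 : 0 < l := by rw [hl]; positivity
  set hx := l / ρ ^ (n + 1) with hhx
  set hy := l / σ ^ (n + 1) with hhy
  have hx0 : 0 < hx := by positivity
  have hy0 : 0 < hy := by positivity
  have eN : ρ * hx = l / ρ ^ n := by rw [hhx, pow_succ]; field_simp
  have eM : σ * hy = l / σ ^ n := by rw [hhy, pow_succ]; field_simp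
  have small : ∀ w : ℝ, 0 < w → w ≤ R ^ 2 → c / w ^ n ≤ l / w ^ (n + 1) := by
    intro w hw hwR
    rw [hc, div_div, pow_succ w, mul_comm (R ^ 2)]
    gcongr
  let S : Set (ℝ × ℝ) := {z | ∃ q : ℕ, ∃ a b : ℤ, 0 < q ∧ (q : ℝ) ≤ R ^ (n + 1) ∧
    z = (((a : ℝ) / q - x) / hx, ((b : ℝ) / q - y) / hy) ∧
    (a : ℝ) / q - x ∈ Set.Icc (-(l / ρ ^ n)) (2 * (l / ρ ^ n)) ∧
    (b : ℝ) / q - y ∈ Set.Icc (-(l / σ ^ n)) (2 * (l / σ ^ n))}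
  have diff : ∀ {L u v w : ℝ}, u - w ∈ Set.Icc (-L) (2 * L) → v - w ∈ Set.Icc (-L) (2 * L) →
      |u - v| ≤ 3 * L := by
    intro L u v w hu hv
    rw [abs_le]
    constructor <;> linarith [hu.1, hu.2, hv.1, hv.2]
  refine card_near_collinear_le (S := S) ?_ ?_
  · rintro _ ⟨q₁, a₁, b₁, hq₁, hQ₁, rfl, hA₁, hB₁⟩ _ ⟨q₂, a₂, b₂, hq₂, hQ₂, rfl, hA₂, hB₂⟩
      _ ⟨q₃, a₃, b₃, hq₃, hQ₃, rfl, hA₃, hB₃⟩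
    have hsmall : 2 * (3 * (l / ρ ^ n) * (3 * (l / σ ^ n))) * (R ^ (n + 1)) ^ 3 < 1 := by
      have e : 2 * (3 * (l / ρ ^ n) * (3 * (l / σ ^ n))) * (R ^ (n + 1)) ^ 3
          = 18 * l ^ 2 * R ^ 3 * ((R ^ 3) ^ n / (ρ * σ) ^ n) := by
        rw [mul_pow]; field_simp; ring
      rw [e, hρσ, div_self (by positivity), hl]
      have : 18 * (1 / (5 * R ^ 2)) ^ 2 * R ^ 3 * 1 = 18 / (25 * R) := by field_simp; ring
      rw [this, div_lt_one (by positivity)]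
      linarith
    have key := rational_points_collinear hq₁ hq₂ hq₃ hQ₁ hQ₂ hQ₃ (diff hA₂ hA₁) (diff hA₃ hA₁)
      (diff hB₂ hB₁) (diff hB₃ hB₁) hsmall
    simp only [← sub_div, sub_sub_sub_cancel_right]
    have e : ∀ u v : ℝ, u / hx * (v / hy) = u * v / (hx * hy) :=
      fun _ _ => div_mul_div_comm _ _ _ _
    rw [e, e, key]
  · intro p hp
    obtain ⟨h1, h2, h3⟩ := hG p hp
    refine ⟨h1, h2, ?_⟩
    simp only [AvoidsRationals, not_forall, not_or, not_lt] at h3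
    obtain ⟨q, hq, hlo, hhi, a, b, X, hX, Y, hY, hXq, hYq⟩ := h3
    have hXa : |(a : ℝ) / q - X| ≤ hx := (abs_sub_div_le_of_rpow_mul_le hq (pow_pos hρ0 n)
      (by rw [hρ]; exact pow_le_rpow_of_pow_le hR0 hs hlo) hXq).trans (small ρ hρ0 hρR)
    have hYb : |(b : ℝ) / q - Y| ≤ hy := (abs_sub_div_le_of_rpow_mul_le hq (pow_pos hσ0 n)
      (by rw [hσ]; exact pow_le_rpow_of_pow_le hR0 ht hlo) hYq).trans (small σ hσ0 hσR)
    have inside : ∀ {w h L u z v : ℝ} {i : ℕ}, 0 < h → 1 ≤ w → w * h = L → i < ⌊w⌋₊ →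
        |u - z| ≤ h → z ∈ Set.Icc (v + i * h) (v + i * h + h) →
        u - v ∈ Set.Icc (-L) (2 * L) ∧ |(u - v) / h - i| ≤ 2 := by
      intro w h L u z v i h0 hw hL hi huz hz
      have hi' : ((i : ℝ) + 1) ≤ w := by
        have h5 : ((i + 1 : ℕ) : ℝ) ≤ ⌊w⌋₊ := by exact_mod_cast hi
        push_cast at h5
        exact h5.trans (Nat.floor_le (by linarith))
      have hi0 : (0 : ℝ) ≤ i := Nat.cast_nonneg i
      rw [abs_le] at huz
      have hb : ((i : ℝ) + 1) * h ≤ w * h := by gcongr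
      have hb' : 1 * h ≤ w * h := by gcongr
      have hb0 : 0 ≤ (i : ℝ) * h := by positivity
      refine ⟨⟨?_, ?_⟩, ?_⟩
      · linarith [hz.1, hz.2]
      · linarith [hz.1, hz.2]
      · have e : (u - v) / h - i = (u - v - i * h) / h := by field_simp
        rw [e, abs_div, abs_of_pos h0, div_le_iff₀ h0, abs_le]
        constructor <;> linarith [hz.1, hz.2]
    have one_le : ∀ {w : ℝ} {i : ℕ}, 0 < w → i < ⌊w⌋₊ → 1 ≤ w := by
      intro w i hw hi
      exact (Nat.one_le_floor_iff w).1 (by omega)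
    obtain ⟨hA, hAi⟩ := inside hx0 (one_le hρ0 h1) eN h1 hXa hX
    obtain ⟨hB, hBj⟩ := inside hy0 (one_le hσ0 h2) eM h2 hYb hY
    exact ⟨_, ⟨q, a, b, hq, hhi.le, rfl, hA, hB⟩, hAi, hBj⟩

/-- Every rectangle has a definite proportion of children avoiding the relevant rationals. -/
lemma exists_children {R s t ρ σ l c : ℝ} (hs : 0 ≤ s) (ht : 0 ≤ t)
    (hR : 40 ≤ R) (hρ : ρ = R ^ (1 + s)) (hσ : σ = R ^ (1 + t)) (hρσ : ρ * σ = R ^ 3)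
    (hRρ : R ≤ ρ) (hRσ : R ≤ σ)
    (hρR : ρ ≤ R ^ 2) (hσR : σ ≤ R ^ 2) (hl : l = 1 / (5 * R ^ 2)) (hc : c = l / R ^ 2)
    (n : ℕ) (z : ℝ × ℝ) :
    ∃ g : Fin ⌈ρ * σ / 4⌉₊ → ℕ × ℕ, Function.Injective g ∧ ∀ d,
      ((g d).1 + 1 : ℝ) ≤ ρ ∧ ((g d).2 + 1 : ℝ) ≤ σ ∧
      AvoidsRationals s t c (R ^ n) (R ^ (n + 1))
      (Set.Icc (z.1 + (g d).1 * (l / ρ ^ (n + 1)))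
        (z.1 + (g d).1 * (l / ρ ^ (n + 1)) + l / ρ ^ (n + 1)))
      (Set.Icc (z.2 + (g d).2 * (l / σ ^ (n + 1)))
        (z.2 + (g d).2 * (l / σ ^ (n + 1)) + l / σ ^ (n + 1))) := by
  classical
  let A : ℕ × ℕ → Prop := fun p => AvoidsRationals s t c (R ^ n) (R ^ (n + 1))
      (Set.Icc (z.1 + p.1 * (l / ρ ^ (n + 1))) (z.1 + p.1 * (l / ρ ^ (n + 1)) + l / ρ ^ (n + 1)))
      (Set.Icc (z.2 + p.2 * (l / σ ^ (n + 1))) (z.2 + p.2 * (l / σ ^ (n + 1)) + l / σ ^ (n + 1)))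
  let T := Finset.range ⌊ρ⌋₊ ×ˢ Finset.range ⌊σ⌋₊
  have hbad : (T.filter fun p => ¬ A p).card ≤ 9 * max ⌊ρ⌋₊ ⌊σ⌋₊ := by
    refine card_not_avoidsRationals_le hs ht hR hρ hσ hρσ hρR hσR hl hc n z.1 z.2 ?_
    intro p hp
    obtain ⟨h1, h2⟩ := Finset.mem_filter.1 hp
    simp only [T, Finset.mem_product, Finset.mem_range] at h1
    exact ⟨h1.1, h1.2, h2⟩
  have hsum := Finset.card_filter_add_card_filter_not (s := T) A
  have hT : T.card = ⌊ρ⌋₊ * ⌊σ⌋₊ := by simp [T]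
  have hP : ⌈ρ * σ / 4⌉₊ ≤ (T.filter A).card := by
    rw [Nat.ceil_le]
    have hN := Nat.lt_floor_add_one ρ
    have hM := Nat.lt_floor_add_one σ
    have hsum' : ((T.filter A).card : ℝ) + (T.filter fun p => ¬ A p).card
        = (⌊ρ⌋₊ : ℝ) * ⌊σ⌋₊ := by
      rw [← Nat.cast_mul, ← hT, ← hsum]; push_cast; rfl
    have hbad' : ((T.filter fun p => ¬ A p).card : ℝ) ≤ 9 * max (⌊ρ⌋₊ : ℝ) ⌊σ⌋₊ := by
      exact_mod_cast hbad
    generalize (⌊ρ⌋₊ : ℝ) = N at *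
    generalize (⌊σ⌋₊ : ℝ) = M at *
    have h4 : 4 * (9 * max N M) ≤ N * M := by
      rcases le_total N M with h | h
      · rw [max_eq_right h]; nlinarith
      · rw [max_eq_left h]; nlinarith
    nlinarith
  let e := Finset.equivFin (T.filter A)
  refine ⟨fun d => (e.symm (Fin.castLE hP d) : ℕ × ℕ), ?_, ?_⟩
  · intro d d' h
    exact Fin.castLE_injective hP (e.symm.injective (Subtype.ext h))
  · intro d
    obtain ⟨h1, h2⟩ := Finset.mem_filter.1 (e.symm (Fin.castLE hP d)).2
    simp only [T, Finset.mem_product, Finset.mem_range] at h1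
    have cast_le : ∀ {w : ℝ} {i : ℕ}, 0 ≤ w → i < ⌊w⌋₊ → (i + 1 : ℝ) ≤ w := by
      intro w i hw hi
      have h5 : ((i + 1 : ℕ) : ℝ) ≤ ⌊w⌋₊ := by exact_mod_cast hi
      push_cast at h5
      exact h5.trans (Nat.floor_le hw)
    exact ⟨cast_le (by linarith) h1.1, cast_le (by linarith) h1.2, h2⟩

/-- The lower left corners of the nested rectangles coded by `ω`. The rectangle of level `n` has
sides `l / ρ ^ n` and `l / σ ^ n`, and `g` selects the children which are kept. -/
noncomputable def corner {P : ℕ} (ρ σ l : ℝ) (g : ℕ → ℝ × ℝ → Fin P → ℕ × ℕ) (ω : ℕ → Fin P) :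
    ℕ → ℝ × ℝ
  | 0 => 0
  | n + 1 =>
    ((corner ρ σ l g ω n).1 + (g n (corner ρ σ l g ω n) (ω n)).1 * (l / ρ ^ (n + 1)),
      (corner ρ σ l g ω n).2 + (g n (corner ρ σ l g ω n) (ω n)).2 * (l / σ ^ (n + 1)))

lemma corner_congr {P : ℕ} {ρ σ l : ℝ} {g : ℕ → ℝ × ℝ → Fin P → ℕ × ℕ} {ω ω' : ℕ → Fin P} {n : ℕ}
    (h : ∀ i < n, ω i = ω' i) : corner ρ σ l g ω n = corner ρ σ l g ω' n := by
  induction n with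
  | zero => rfl
  | succ n ih =>
    simp only [corner, ih fun i hi => h i (by omega), h n (by omega)]

lemma measurable_corner {P : ℕ} {ρ σ l : ℝ} {g : ℕ → ℝ × ℝ → Fin P → ℕ × ℕ} (n : ℕ) :
    Measurable fun ω : ℕ → Fin P => corner ρ σ l g ω n := by
  rcases isEmpty_or_nonempty (Fin P) with hP | ⟨⟨d₀⟩⟩
  · exact measurable_of_empty _
  let F : (Fin n → Fin P) → ℝ × ℝ := fun v =>
    corner ρ σ l g (fun i => if h : i < n then v ⟨i, h⟩ else d₀) n
  have e : (fun ω : ℕ → Fin P => corner ρ σ l g ω n) = F ∘ fun ω i => ω i := by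
    funext ω
    exact corner_congr fun i hi => by simp [hi]
  rw [e]
  exact (measurable_of_finite F).comp (measurable_pi_lambda _ fun i => measurable_pi_apply _)

lemma separation_step {h h' x x' : ℝ} {i j : ℕ} (h0 : 0 ≤ h') (hi : (i + 1 : ℝ) * h' ≤ h)
    (hj : (j + 1 : ℝ) * h' ≤ h) (hx : h ≤ |x - x'|) :
    h' ≤ |x + i * h' - (x' + j * h')| := by
  have hi0 : 0 ≤ (i : ℝ) * h' := by positivity
  have hj0 : 0 ≤ (j : ℝ) * h' := by positivity
  rw [le_abs] at hx ⊢
  rcases hx with hx | hx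
  · left; linarith
  · right; linarith

lemma le_abs_of_digits_ne {h x : ℝ} {i j : ℕ} (h0 : 0 ≤ h) (hij : i ≠ j) :
    h ≤ |x + i * h - (x + j * h)| := by
  have h1 : (1 : ℝ) ≤ |(i : ℝ) - j| := by
    have h2 : (1 : ℤ) ≤ |(i : ℤ) - j| := Int.one_le_abs (by omega)
    exact_mod_cast h2
  have e : x + i * h - (x + j * h) = (i - j) * h := by ring
  rw [e, abs_mul, abs_of_nonneg h0]
  nlinarith

lemma succ_digit_mul_le {ρ l : ℝ} (hρ : 0 < ρ) (hl : 0 < l) {i n : ℕ} (hi : (i + 1 : ℝ) ≤ ρ) :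
    (i + 1 : ℝ) * (l / ρ ^ (n + 1)) ≤ l / ρ ^ n := by
  calc (i + 1 : ℝ) * (l / ρ ^ (n + 1)) ≤ ρ * (l / ρ ^ (n + 1)) := by gcongr
    _ = l / ρ ^ n := by rw [pow_succ]; field_simp

/-- Distinct rectangles of the same level have disjoint interiors. -/
lemma corner_separated {P : ℕ} {ρ σ l : ℝ} (hρ : 0 < ρ) (hσ : 0 < σ) (hl : 0 < l)
    {g : ℕ → ℝ × ℝ → Fin P → ℕ × ℕ} (hg : ∀ n z, Function.Injective (g n z))
    (hg₁ : ∀ n z d, ((g n z d).1 + 1 : ℝ) ≤ ρ) (hg₂ : ∀ n z d, ((g n z d).2 + 1 : ℝ) ≤ σ)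
    (ω ω' : ℕ → Fin P) (n : ℕ) :
    (∀ i < n, ω i = ω' i) ∨ l / ρ ^ n ≤ |(corner ρ σ l g ω n).1 - (corner ρ σ l g ω' n).1| ∨
      l / σ ^ n ≤ |(corner ρ σ l g ω n).2 - (corner ρ σ l g ω' n).2| := by
  induction n with
  | zero => left; simp
  | succ n ih =>
    have hρn : 0 ≤ l / ρ ^ (n + 1) := by positivity
    have hσn : 0 ≤ l / σ ^ (n + 1) := by positivity
    rcases ih with h | h | h
    · by_cases hd : ω n = ω' n
      · left
        intro i hi
        rcases Nat.lt_succ_iff_lt_or_eq.1 hi with hi | rfl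
        exacts [h i hi, hd]
      · right
        simp only [corner, corner_congr h]
        by_cases h1 : (g n (corner ρ σ l g ω' n) (ω n)).1 = (g n (corner ρ σ l g ω' n) (ω' n)).1
        · right
          refine le_abs_of_digits_ne hσn fun h2 => hd (hg _ _ (Prod.ext h1 h2))
        · left
          exact le_abs_of_digits_ne hρn h1
    · right; left
      exact separation_step hρn (succ_digit_mul_le hρ hl (hg₁ _ _ _))
        (succ_digit_mul_le hρ hl (hg₁ _ _ _)) h
    · right; right
      exact separation_step hσn (succ_digit_mul_le hσ hl (hg₂ _ _ _))
        (succ_digit_mul_le hσ hl (hg₂ _ _ _)) h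

lemma exists_tendsto_of_nested {x w : ℕ → ℝ} (hw : ∀ n, 0 ≤ w n) (h : ∀ n, x n ≤ x (n + 1))
    (h' : ∀ n, x (n + 1) + w (n + 1) ≤ x n + w n) :
    ∃ X, Tendsto x atTop (nhds X) ∧ ∀ n, X ∈ Set.Icc (x n) (x n + w n) := by
  have hm : Monotone x := monotone_nat_of_le_succ h
  have ha : Antitone fun n => x n + w n := antitone_nat_of_succ_le h'
  have hle : ∀ m n, x m ≤ x n + w n := by
    intro m n
    calc x m ≤ x (max m n) := hm (le_max_left _ _)
      _ ≤ x (max m n) + w (max m n) := by linarith [hw (max m n)]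
      _ ≤ x n + w n := ha (le_max_right _ _)
  have hb : BddAbove (Set.range x) := ⟨x 0 + w 0, by rintro _ ⟨m, rfl⟩; exact hle m 0⟩
  exact ⟨⨆ n, x n, tendsto_atTop_ciSup hm hb, fun n => ⟨le_ciSup hb n, ciSup_le fun m => hle m n⟩⟩

/-- The coding map of the nested rectangles. -/
lemma exists_coding {P : ℕ} {ρ σ l : ℝ} (hρ : 0 < ρ) (hσ : 0 < σ) (hl : 0 < l)
    {g : ℕ → ℝ × ℝ → Fin P → ℕ × ℕ}
    (hg₁ : ∀ n z d, ((g n z d).1 + 1 : ℝ) ≤ ρ) (hg₂ : ∀ n z d, ((g n z d).2 + 1 : ℝ) ≤ σ) :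
    ∃ φ : (ℕ → Fin P) → ℝ × ℝ, Measurable φ ∧ ∀ ω n,
      (φ ω).1 ∈ Set.Icc (corner ρ σ l g ω n).1 ((corner ρ σ l g ω n).1 + l / ρ ^ n) ∧
      (φ ω).2 ∈ Set.Icc (corner ρ σ l g ω n).2 ((corner ρ σ l g ω n).2 + l / σ ^ n) := by
  have H₁ : ∀ ω, ∃ X, Tendsto (fun n => (corner ρ σ l g ω n).1) atTop (nhds X) ∧
      ∀ n, X ∈ Set.Icc (corner ρ σ l g ω n).1 ((corner ρ σ l g ω n).1 + l / ρ ^ n) := by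
    intro ω
    refine exists_tendsto_of_nested (x := fun n => (corner ρ σ l g ω n).1)
      (w := fun n => l / ρ ^ n) (fun n => by positivity) (fun n => ?_) fun n => ?_
    · simp only [corner, le_add_iff_nonneg_right]
      positivity
    · have := succ_digit_mul_le hρ hl (n := n) (hg₁ n (corner ρ σ l g ω n) (ω n))
      simp only [corner]
      linarith
  have H₂ : ∀ ω, ∃ Y, Tendsto (fun n => (corner ρ σ l g ω n).2) atTop (nhds Y) ∧
      ∀ n, Y ∈ Set.Icc (corner ρ σ l g ω n).2 ((corner ρ σ l g ω n).2 + l / σ ^ n) := by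
    intro ω
    refine exists_tendsto_of_nested (x := fun n => (corner ρ σ l g ω n).2)
      (w := fun n => l / σ ^ n) (fun n => by positivity) (fun n => ?_) fun n => ?_
    · simp only [corner, le_add_iff_nonneg_right]
      positivity
    · have := succ_digit_mul_le hσ hl (n := n) (hg₂ n (corner ρ σ l g ω n) (ω n))
      simp only [corner]
      linarith
  choose X hX hX' using H₁
  choose Y hY hY' using H₂
  refine ⟨fun ω => (X ω, Y ω), ?_, fun ω n => ⟨hX' ω n, hY' ω n⟩⟩
  refine Measurable.prodMk ?_ ?_
  · exact measurable_of_tendsto_metrizable (fun n => (measurable_corner n).fst)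
      (tendsto_pi_nhds.2 hX)
  · exact measurable_of_tendsto_metrizable (fun n => (measurable_corner n).snd)
      (tendsto_pi_nhds.2 hY)

/-- The uniform product measure on sequences of digits. -/
noncomputable def digitMeasure (P : ℕ) : MeasureTheory.Measure (ℕ → Fin P) :=
  MeasureTheory.Measure.infinitePi fun _ => ProbabilityTheory.uniformOn (Set.univ : Set (Fin P))

lemma digitMeasure_cylinder {P : ℕ} [NeZero P] (ω₀ : ℕ → Fin P) (n : ℕ) :
    digitMeasure P {ω | ∀ i < n, ω i = ω₀ i} = ENNReal.ofReal (((P : ℝ)⁻¹) ^ n) := by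
  have : {ω : ℕ → Fin P | ∀ i < n, ω i = ω₀ i} =
      Set.pi (Finset.range n : Finset ℕ) fun i => {ω₀ i} := by
    ext ω; simp [Set.mem_pi]
  rw [this, digitMeasure, MeasureTheory.Measure.infinitePi_pi _ fun _ _ => MeasurableSet.singleton _]
  have hP : (0 : ℝ) < P := by exact_mod_cast Nat.pos_of_ne_zero (NeZero.ne P)
  rw [ENNReal.ofReal_pow (by positivity), ENNReal.ofReal_inv_of_pos hP]
  simp [ProbabilityTheory.uniformOn_univ]

lemma floor_mem_Icc_of_near {L X X₀ x r : ℝ} (hL : 0 < L) (hX : X ∈ Set.Icc x (x + L))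
    (hr : |X - X₀| ≤ r) :
    ⌊x / L⌋ ∈ Finset.Icc ⌊(X₀ - r) / L - 1⌋ ⌊(X₀ + r) / L⌋ := by
  rw [abs_le] at hr
  rw [Finset.mem_Icc]
  constructor
  · apply Int.floor_le_floor
    rw [sub_le_iff_le_add, div_add_one hL.ne']
    gcongr
    linarith [hX.2]
  · apply Int.floor_le_floor
    gcongr
    linarith [hX.1]

lemma card_Icc_floor_le {L X₀ r : ℝ} (hL : 0 < L) (hr : L ≤ r) :
    ((Finset.Icc ⌊(X₀ - r) / L - 1⌋ ⌊(X₀ + r) / L⌋).card : ℝ) ≤ 5 * (r / L) := by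
  have h1 := Int.floor_le ((X₀ + r) / L)
  have h2 := Int.lt_floor_add_one ((X₀ - r) / L - 1)
  have h3 : 1 ≤ r / L := (one_le_div hL).2 hr
  have h4 : (X₀ + r) / L - (X₀ - r) / L = 2 * (r / L) := by ring
  have h5 : ⌊(X₀ - r) / L - 1⌋ ≤ ⌊(X₀ + r) / L⌋ + 1 := by
    have : (⌊(X₀ - r) / L - 1⌋ : ℝ) ≤ ⌊(X₀ + r) / L⌋ + 1 := by
      linarith [Int.floor_le ((X₀ - r) / L - 1), Int.lt_floor_add_one ((X₀ + r) / L)]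
    exact_mod_cast this
  have h6 : ((Finset.Icc ⌊(X₀ - r) / L - 1⌋ ⌊(X₀ + r) / L⌋).card : ℤ) =
      ⌊(X₀ + r) / L⌋ + 1 - ⌊(X₀ - r) / L - 1⌋ := by
    rw [Int.card_Icc, Int.toNat_of_nonneg (by linarith)]
  have h7 : ((Finset.Icc ⌊(X₀ - r) / L - 1⌋ ⌊(X₀ + r) / L⌋).card : ℝ) =
      ⌊(X₀ + r) / L⌋ + 1 - ⌊(X₀ - r) / L - 1⌋ := by exact_mod_cast h6
  rw [h7]
  linarith

lemma abs_sub_lt_of_floor_div_eq {L x x' : ℝ} (hL : 0 < L) (h : ⌊x / L⌋ = ⌊x' / L⌋) :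
    |x - x'| < L := by
  have := Int.abs_sub_lt_one_of_floor_eq_floor h
  rwa [← sub_div, abs_div, abs_of_pos hL, div_lt_one hL] at this

/-- The measure of a set whose size is comparable to a rectangle of level `n` or larger. -/
lemma digitMeasure_preimage_le {P : ℕ} [NeZero P] {ρ σ l : ℝ} (hρ : 0 < ρ) (hσ : 0 < σ)
    (hl : 0 < l) {g : ℕ → ℝ × ℝ → Fin P → ℕ × ℕ} (hg : ∀ n z, Function.Injective (g n z))
    (hg₁ : ∀ n z d, ((g n z d).1 + 1 : ℝ) ≤ ρ) (hg₂ : ∀ n z d, ((g n z d).2 + 1 : ℝ) ≤ σ)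
    {φ : (ℕ → Fin P) → ℝ × ℝ} (hφ : ∀ ω n,
      (φ ω).1 ∈ Set.Icc (corner ρ σ l g ω n).1 ((corner ρ σ l g ω n).1 + l / ρ ^ n) ∧
      (φ ω).2 ∈ Set.Icc (corner ρ σ l g ω n).2 ((corner ρ σ l g ω n).2 + l / σ ^ n))
    {U : Set (ℝ × ℝ)} {r : ℝ} (hU : ∀ p ∈ U, ∀ p' ∈ U, dist p p' ≤ r) {n : ℕ}
    (hnρ : l / ρ ^ n ≤ r) (hnσ : l / σ ^ n ≤ r) :
    digitMeasure P (φ ⁻¹' U) ≤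
      ENNReal.ofReal ((5 * (r / (l / ρ ^ n))) * (5 * (r / (l / σ ^ n))) * ((P : ℝ)⁻¹) ^ n) := by
  rcases (φ ⁻¹' U).eq_empty_or_nonempty with h | ⟨ω₀, hω₀⟩
  · simp [h]
  have hLρ : 0 < l / ρ ^ n := by positivity
  have hLσ : 0 < l / σ ^ n := by positivity
  let F := Finset.Icc ⌊((φ ω₀).1 - r) / (l / ρ ^ n) - 1⌋ ⌊((φ ω₀).1 + r) / (l / ρ ^ n)⌋ ×ˢ
    Finset.Icc ⌊((φ ω₀).2 - r) / (l / σ ^ n) - 1⌋ ⌊((φ ω₀).2 + r) / (l / σ ^ n)⌋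
  let A : ℤ × ℤ → Set (ℕ → Fin P) := fun k =>
    {ω | ⌊(corner ρ σ l g ω n).1 / (l / ρ ^ n)⌋ = k.1 ∧
      ⌊(corner ρ σ l g ω n).2 / (l / σ ^ n)⌋ = k.2}
  have hcover : φ ⁻¹' U ⊆ ⋃ k ∈ F, A k := by
    intro ω hω
    have hd := hU _ hω _ hω₀
    rw [Prod.dist_eq, max_le_iff, Real.dist_eq, Real.dist_eq] at hd
    simp only [Set.mem_iUnion]
    exact ⟨(_, _), Finset.mem_product.2 ⟨floor_mem_Icc_of_near hLρ (hφ ω n).1 hd.1,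
      floor_mem_Icc_of_near hLσ (hφ ω n).2 hd.2⟩, rfl, rfl⟩
  have hA : ∀ k, digitMeasure P (A k) ≤ ENNReal.ofReal (((P : ℝ)⁻¹) ^ n) := by
    intro k
    rcases (A k).eq_empty_or_nonempty with h | ⟨ω₁, hω₁⟩
    · simp [h]
    rw [← digitMeasure_cylinder ω₁ n]
    refine MeasureTheory.measure_mono fun ω hω => ?_
    rcases corner_separated hρ hσ hl hg hg₁ hg₂ ω ω₁ n with h | h | h
    · exact h
    · exact absurd (abs_sub_lt_of_floor_div_eq hLρ (hω.1.trans hω₁.1.symm)) h.not_gt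
    · exact absurd (abs_sub_lt_of_floor_div_eq hLσ (hω.2.trans hω₁.2.symm)) h.not_gt
  calc digitMeasure P (φ ⁻¹' U) ≤ digitMeasure P (⋃ k ∈ F, A k) :=
        MeasureTheory.measure_mono hcover
    _ ≤ ∑ k ∈ F, digitMeasure P (A k) := MeasureTheory.measure_biUnion_finset_le _ _
    _ ≤ ∑ _k ∈ F, ENNReal.ofReal (((P : ℝ)⁻¹) ^ n) := Finset.sum_le_sum fun k _ => hA k
    _ = ENNReal.ofReal (F.card * ((P : ℝ)⁻¹) ^ n) := by
        rw [Finset.sum_const, nsmul_eq_mul, ENNReal.ofReal_mul (by positivity),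
          ENNReal.ofReal_natCast]
    _ ≤ _ := by
        apply ENNReal.ofReal_le_ofReal
        gcongr
        rw [Finset.card_product, Nat.cast_mul]
        exact mul_le_mul (card_Icc_floor_le hLρ hnρ) (card_Icc_floor_le hLσ hnσ)
          (Nat.cast_nonneg _) ((Nat.cast_nonneg _).trans (card_Icc_floor_le (X₀ := 0) hLρ hnρ))

/-- The coding map spreads the digit measure almost as evenly as Lebesgue measure. -/
lemma digitMeasure_preimage_le_rpow {P : ℕ} [NeZero P] {R ρ σ l d : ℝ} (hR : 1 < R) (hRρ : R ≤ ρ)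
    (hRσ : R ≤ σ) (hl : 0 < l) (hl1 : l ≤ 1) (hP : ρ * σ ≤ 4 * P) (hd : d ≤ 2)
    (hRd : 4 ≤ R ^ (2 - d))
    {g : ℕ → ℝ × ℝ → Fin P → ℕ × ℕ} (hg : ∀ n z, Function.Injective (g n z))
    (hg₁ : ∀ n z d, ((g n z d).1 + 1 : ℝ) ≤ ρ) (hg₂ : ∀ n z d, ((g n z d).2 + 1 : ℝ) ≤ σ)
    {φ : (ℕ → Fin P) → ℝ × ℝ} (hφ : ∀ ω n,
      (φ ω).1 ∈ Set.Icc (corner ρ σ l g ω n).1 ((corner ρ σ l g ω n).1 + l / ρ ^ n) ∧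
      (φ ω).2 ∈ Set.Icc (corner ρ σ l g ω n).2 ((corner ρ σ l g ω n).2 + l / σ ^ n))
    {U : Set (ℝ × ℝ)} {r : ℝ} (hr : 0 < r) (hr1 : r ≤ 1)
    (hU : ∀ p ∈ U, ∀ p' ∈ U, dist p p' ≤ r) :
    digitMeasure P (φ ⁻¹' U) ≤ ENNReal.ofReal (25 * R ^ (2 - d) / l ^ 2 * r ^ d) := by
  have hR0 : 0 < R := by linarith
  have hρ : 0 < ρ := by linarith
  have hσ : 0 < σ := by linarith
  have hP0 : (0 : ℝ) < P := by exact_mod_cast Nat.pos_of_ne_zero (NeZero.ne P)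
  obtain ⟨m, hm, hm'⟩ := exists_nat_pow_near ((one_le_div hr).2 hr1) hR
  have side : ∀ w, R ≤ w → l / w ^ (m + 1) ≤ r := by
    intro w hw
    rw [div_le_iff₀ (by have : 0 < w := by linarith
                        positivity)]
    calc l ≤ 1 := hl1
      _ ≤ r * R ^ (m + 1) := by rw [mul_comm]; exact ((div_lt_iff₀ hr).1 hm').le
      _ ≤ r * w ^ (m + 1) := by gcongr
  refine (digitMeasure_preimage_le hρ hσ hl hg hg₁ hg₂ hφ hU (side ρ hRρ) (side σ hRσ)).trans ?_
  apply ENNReal.ofReal_le_ofReal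
  have e : 5 * (r / (l / ρ ^ (m + 1))) * (5 * (r / (l / σ ^ (m + 1)))) * ((P : ℝ)⁻¹) ^ (m + 1) =
      25 / l ^ 2 * r ^ 2 * (ρ * σ / P) ^ (m + 1) := by
    rw [inv_pow, div_pow, mul_pow]; field_simp; norm_num
  have h4 : ρ * σ / P ≤ 4 := (div_le_iff₀ hP0).2 hP
  have hpow : (ρ * σ / P) ^ (m + 1) ≤ (R / r) ^ (2 - d) := by
    calc (ρ * σ / P) ^ (m + 1) ≤ (R ^ (2 - d)) ^ (m + 1) := by
          gcongr
          exact h4.trans hRd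
      _ = (R ^ (m + 1)) ^ (2 - d) := by
          rw [← Real.rpow_natCast, ← Real.rpow_mul hR0.le, mul_comm, Real.rpow_mul hR0.le,
            Real.rpow_natCast]
      _ ≤ (R / r) ^ (2 - d) := by
          have : R ^ (m + 1) ≤ R / r := by
            calc R ^ (m + 1) = R ^ m * R := pow_succ _ _
              _ ≤ 1 / r * R := by gcongr
              _ = R / r := by ring
          exact Real.rpow_le_rpow (by positivity) this (by linarith)
  have hrd : r ^ 2 = r ^ d * r ^ (2 - d) := by
    rw [← Real.rpow_add hr, add_sub_cancel, Real.rpow_two]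
  rw [e]
  calc 25 / l ^ 2 * r ^ 2 * (ρ * σ / P) ^ (m + 1)
      ≤ 25 / l ^ 2 * r ^ 2 * (R / r) ^ (2 - d) := by gcongr
    _ = 25 * R ^ (2 - d) / l ^ 2 * r ^ d := by
        rw [hrd, Real.div_rpow hR0.le hr.le]
        field_simp

/-- Mass distribution principle, for a measure given by a coding map. -/
lemma le_dimH_of_preimage_le {Ω X : Type*} [MeasurableSpace Ω] [MetricSpace X] [MeasurableSpace X]
    [BorelSpace X] {ν : MeasureTheory.Measure Ω} {φ : Ω → X} (hφ : Measurable φ) (hν : ν ≠ 0)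
    {E : Set X} (hE : ∀ ω, φ ω ∈ E) {C : ℝ} (hC : 0 < C) {d : NNReal} (hd : 0 < d)
    (h : ∀ (U : Set X) (r : ℝ), 0 < r → r ≤ 1 → (∀ p ∈ U, ∀ p' ∈ U, dist p p' ≤ r) →
      ν (φ ⁻¹' U) ≤ ENNReal.ofReal (C * r ^ (d : ℝ))) :
    (d : ENNReal) ≤ dimH E := by
  have hmass : ∀ U : Set X, ediam U ≤ 1 →
      ν (φ ⁻¹' U) ≤ ENNReal.ofReal C * ediam U ^ (d : ℝ) := by
    intro U hU
    have hne : ediam U ≠ ⊤ := ne_top_of_le_ne_top ENNReal.one_ne_top hU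
    have hdiam : ∀ p ∈ U, ∀ p' ∈ U, dist p p' ≤ diam U := fun p hp p' hp' =>
      dist_le_diam_of_mem' hne hp hp'
    have hdr : ediam U = ENNReal.ofReal (diam U) := (ENNReal.ofReal_toReal hne).symm
    rcases (diam_nonneg (s := U)).eq_or_lt with h0 | h0
    · have hlim : Tendsto (fun r : ℝ => ENNReal.ofReal (C * r ^ (d : ℝ))) (nhdsWithin 0 (Set.Ioi 0))
          (nhds (ENNReal.ofReal (C * 0 ^ (d : ℝ)))) := by
        refine Tendsto.mono_left ?_ nhdsWithin_le_nhds
        exact ((ENNReal.continuous_ofReal.comp (continuous_const.mul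
          (Real.continuous_rpow_const (by positivity)))).tendsto 0)
      have hd' : (d : ℝ) ≠ 0 := by exact_mod_cast hd.ne'
      rw [Real.zero_rpow hd', mul_zero, ENNReal.ofReal_zero] at hlim
      refine (ge_of_tendsto hlim ?_).trans zero_le
      filter_upwards [Ioc_mem_nhdsGT (zero_lt_one' ℝ)] with r hr
      exact h U r hr.1 hr.2 fun p hp p' hp' => (hdiam p hp p' hp').trans (h0 ▸ hr.1.le)
    · have h1 : diam U ≤ 1 := ENNReal.toReal_le_of_le_ofReal zero_le_one (by simpa using hU)
      rw [hdr, ENNReal.ofReal_rpow_of_pos h0, ← ENNReal.ofReal_mul hC.le]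
      exact h U _ h0 h1 hdiam
  have hC0 : ENNReal.ofReal C ≠ 0 := by simpa using hC
  have hle : (ENNReal.ofReal C)⁻¹ • ν.map φ ≤ MeasureTheory.Measure.hausdorffMeasure (d : ℝ) := by
    refine MeasureTheory.Measure.le_hausdorffMeasure _ _ 1 zero_lt_one fun U hU => ?_
    rw [MeasureTheory.Measure.smul_apply, smul_eq_mul]
    calc (ENNReal.ofReal C)⁻¹ * ν.map φ U ≤ (ENNReal.ofReal C)⁻¹ * ν.map φ (closure U) := by
          gcongr; exact subset_closure
      _ = (ENNReal.ofReal C)⁻¹ * ν (φ ⁻¹' closure U) := by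
          rw [MeasureTheory.Measure.map_apply hφ isClosed_closure.measurableSet]
      _ ≤ (ENNReal.ofReal C)⁻¹ * (ENNReal.ofReal C * ediam U ^ (d : ℝ)) := by
          gcongr
          rw [← ediam_closure]
          exact hmass _ (by rwa [ediam_closure])
      _ = ediam U ^ (d : ℝ) := by
          rw [← mul_assoc, ENNReal.inv_mul_cancel hC0 ENNReal.ofReal_ne_top, one_mul]
  refine le_dimH_of_hausdorffMeasure_ne_zero fun h0 => ?_
  have h1 := hle E
  rw [h0, nonpos_iff_eq_zero, MeasureTheory.Measure.smul_apply, smul_eq_mul, mul_eq_zero] at h1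
  have h2 := h1.resolve_left (by simp)
  have h3 := MeasureTheory.Measure.le_map_apply (μ := ν) hφ.aemeasurable E
  rw [h2, nonpos_iff_eq_zero, show φ ⁻¹' E = Set.univ from Set.eq_univ_of_forall hE,
    MeasureTheory.Measure.measure_univ_eq_zero] at h3
  exact hν h3

lemma mem_badPair_of_avoidsRationals {s t c R : ℝ} (hR : 1 < R) (hc : 0 < c) {p : ℝ × ℝ}
    {I J : ℕ → Set ℝ} (hp₁ : ∀ n, p.1 ∈ I n) (hp₂ : ∀ n, p.2 ∈ J n)
    (h : ∀ n, AvoidsRationals s t c (R ^ n) (R ^ (n + 1)) (I n) (J n)) :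
    p ∈ badPair s t := by
  refine hc.trans_le (le_ciInf fun q => ?_)
  obtain ⟨n, hn, hn'⟩ := exists_nat_pow_near (x := ((q : ℕ) : ℝ))
    (by exact_mod_cast q.pos) hR
  rw [le_max_iff]
  exact (h n q q.pos hn hn' (round _) (round _) _ (hp₁ n) _ (hp₂ n)).imp le_of_lt le_of_lt

lemma exists_large_base {d : ℝ} (hd : d < 2) : ∃ R : ℝ, 40 ≤ R ∧ 4 ≤ R ^ (2 - d) :=
  ((eventually_ge_atTop 40).and
    ((tendsto_rpow_atTop (sub_pos.2 hd)).eventually_ge_atTop 4)).exists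

lemma le_dimH_badPair {s t : ℝ} (hs : 0 ≤ s) (ht : 0 ≤ t) (hst : s + t = 1) {d : NNReal}
    (hd0 : 0 < d) (hd : d < 2) : (d : ENNReal) ≤ dimH (badPair s t) := by
  have hd2 : (d : ℝ) < 2 := by exact_mod_cast hd
  obtain ⟨R, hR, hRd⟩ := exists_large_base hd2
  have hR0 : 0 < R := by linarith
  have hR1 : 1 < R := by linarith
  set ρ := R ^ (1 + s) with hρ
  set σ := R ^ (1 + t) with hσ
  have hρσ : ρ * σ = R ^ 3 := by
    rw [hρ, hσ, ← Real.rpow_add hR0, ← Real.rpow_natCast]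
    congr 1
    push_cast
    linarith
  have le_base : ∀ u : ℝ, 0 ≤ u → R ≤ R ^ (1 + u) := fun u hu =>
    Real.self_le_rpow_of_one_le hR1.le (by linarith)
  have le_sq : ∀ u : ℝ, u ≤ 1 → R ^ (1 + u) ≤ R ^ 2 := by
    intro u hu
    rw [← Real.rpow_two]
    exact Real.rpow_le_rpow_of_exponent_le hR1.le (by linarith)
  have hRρ : R ≤ ρ := le_base s hs
  have hRσ : R ≤ σ := le_base t ht
  set l := 1 / (5 * R ^ 2) with hl
  have hl0 : 0 < l := by positivity
  have hl1 : l ≤ 1 := by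
    rw [hl, div_le_one (by positivity)]
    nlinarith
  have children := exists_children hs ht hR hρ hσ hρσ hRρ hRσ (le_sq s (by linarith))
    (le_sq t (by linarith)) hl rfl
  set P := ⌈ρ * σ / 4⌉₊ with hPdef
  choose g hg hg' using children
  have hP : ρ * σ ≤ 4 * P := by linarith [Nat.le_ceil (ρ * σ / 4)]
  have : NeZero P := ⟨by
    rw [hPdef, hρσ]
    exact (Nat.ceil_pos.2 (by positivity)).ne'⟩
  have hg₁ : ∀ n z d, ((g n z d).1 + 1 : ℝ) ≤ ρ := fun n z d => (hg' n z d).1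
  have hg₂ : ∀ n z d, ((g n z d).2 + 1 : ℝ) ≤ σ := fun n z d => (hg' n z d).2.1
  obtain ⟨φ, hφm, hφ⟩ := exists_coding (hR0.trans_le hRρ) (hR0.trans_le hRσ) hl0 hg₁ hg₂
  refine le_dimH_of_preimage_le (ν := digitMeasure P) hφm ?_ (fun ω => ?_)
    (C := 25 * R ^ (2 - (d : ℝ)) / l ^ 2) (by positivity) hd0 fun U r hr hr1 hU =>
      digitMeasure_preimage_le_rpow hR1 hRρ hRσ hl0 hl1 hP hd2.le hRd hg hg₁ hg₂ hφ hr hr1 hU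
  · intro h0
    have := digitMeasure_cylinder (P := P) (fun _ => 0) 0
    simp [h0] at this
  · exact mem_badPair_of_avoidsRationals hR1 (c := l / R ^ 2) (by positivity)
      (fun n => (hφ ω (n + 1)).1) (fun n => (hφ ω (n + 1)).2)
      fun n => (hg' n (corner ρ σ l g ω n) (ω n)).2.2

/-- For all `s, t ≥ 0` with `s + t = 1`, the set `Bad(s,t)` has full Hausdorff dimension
in ℝ². -/
theorem dimH_badPair (s t : ℝ) (hs : 0 ≤ s) (ht : 0 ≤ t) (hst : s + t = 1) :
    dimH (badPair s t) = 2 := by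
  apply le_antisymm
  · refine (dimH_mono (Set.subset_univ _)).trans ?_
    rw [Real.dimH_univ_eq_finrank, Module.finrank_prod]
    norm_num
  · refine ENNReal.le_of_forall_nnreal_lt fun d hd => ?_
    rcases (zero_le (a := d)).eq_or_lt with rfl | hd0
    · simp
    · exact le_dimH_badPair hs ht hst hd0 (by exact_mod_cast hd)
end
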